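/- Let σ = (σ_1 ≥ … ≥ σ_{2p}) be a weakly decreasing sequence of real numbers and let ν = (ν_1 ≥ … ≥ ν_p) be a weakly decreasing sequence of real numbers. Then there exist real symmetric 2p×2p matrices A and B, each with ordered spectrum σ, such that A + B has ordered spectrum ν^{(2)}, if and only if there exist real symmetric p×p matrices a and b with ordered spectra σ_- and σ_+ respectively such that a + b has ordered spectrum ν. -/

import Mathlib

open Polynomial in
/-- `μ` (weakly decreasing) is the ordered spectrum of the real matrix `A`:
the characteristic polynomial of `A` is `∏ i (X - μ i)`, i.e. the `μ i` are the
eigenvalues of `A` with multiplicity, listed in weakly decreasing order. -/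
def HasOrdSpecR {n : ℕ} (A : Matrix (Fin n) (Fin n) ℝ) (μ : Fin n → ℝ) : Prop :=
  Antitone μ ∧ A.charpoly = ∏ i, (X - C (μ i))

open Polynomial in
/-- `μ` (weakly decreasing, real) is the ordered spectrum of the complex matrix `A`. -/
def HasOrdSpecC {n : ℕ} (A : Matrix (Fin n) (Fin n) ℂ) (μ : Fin n → ℝ) : Prop :=
  Antitone μ ∧ A.charpoly = ∏ i, (X - C ((μ i : ℂ)))

/-- For `σ = (σ₁ ≥ … ≥ σ_{2p})`, `sminusR σ = σ₋ = (σ₁, σ₃, …, σ_{2p-1})`. -/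
def sminusR {p : ℕ} (σ : Fin (2 * p) → ℝ) : Fin p → ℝ :=
  fun i => σ ⟨2 * i.1, by have := i.2; omega⟩

/-- For `σ = (σ₁ ≥ … ≥ σ_{2p})`, `splusR σ = σ₊ = (σ₂, σ₄, …, σ_{2p})`. -/
def splusR {p : ℕ} (σ : Fin (2 * p) → ℝ) : Fin p → ℝ :=
  fun i => σ ⟨2 * i.1 + 1, by have := i.2; omega⟩

/-- For `ν = (ν₁ ≥ … ≥ ν_p)`, `dupR ν = ν⁽²⁾ = (ν₁, ν₁, ν₂, ν₂, …, ν_p, ν_p)`. -/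
def dupR {p : ℕ} (ν : Fin p → ℝ) : Fin (2 * p) → ℝ :=
  fun i => ν ⟨i.1 / 2, by have := i.2; omega⟩

section
lemma constr_generic {X : Type*} [TopologicalSpace X] (g : X) (hg : ∀ V : Set X, IsOpen V → V.Nonempty → g ∈ V)
    (s : Set X) (hs : Topology.IsConstructible s) :
    (∃ U : Set X, IsOpen U ∧ U.Nonempty ∧ U ⊆ s) ∨ (∃ U : Set X, IsOpen U ∧ U.Nonempty ∧ U ⊆ sᶜ) := by
  induction hs using Topology.IsConstructible.empty_union_induction with
  | open_retrocompact U hU hc =>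
    rcases U.eq_empty_or_nonempty with rfl | h
    · right; exact ⟨Set.univ, isOpen_univ, ⟨g, trivial⟩, by simp⟩
    · left; exact ⟨U, hU, h, le_rfl⟩
  | union s hs t ht h1 h2 =>
    rcases h1 with ⟨U, hU, hn, hs⟩ | ⟨U, hU, hn, hs⟩
    · left; exact ⟨U, hU, hn, hs.trans Set.subset_union_left⟩
    · rcases h2 with ⟨V, hV, hn', hs'⟩ | ⟨V, hV, hn', hs'⟩
      · left; exact ⟨V, hV, hn', hs'.trans Set.subset_union_right⟩
      · right
        refine ⟨U ∩ V, hU.inter hV, ⟨g, hg U hU hn, hg V hV hn'⟩, ?_⟩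
        rw [Set.compl_union]
        exact Set.inter_subset_inter hs hs'
  | compl s hs h =>
    rw [compl_compl]
    exact h.symm

open Polynomial in
lemma cofinite_of_infinite {ι τ : Type} [Fintype ι] [Fintype τ] (F : τ → MvPolynomial (Option ι) ℂ)
    (hinf : {t : ℂ | ∃ x : ι → ℂ, ∀ j, MvPolynomial.eval (fun o => o.elim t x) (F j) = 0}.Infinite) :
    {t : ℂ | ∃ x : ι → ℂ, ∀ j, MvPolynomial.eval (fun o => o.elim t x) (F j) = 0}ᶜ.Finite := by
  set I : Ideal (MvPolynomial (Option ι) ℂ) := Ideal.span (Set.range F) with hI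
  let f0 : ℂ[X] →+* MvPolynomial (Option ι) ℂ := (Polynomial.aeval (MvPolynomial.X none : MvPolynomial (Option ι) ℂ)).toRingHom
  let f : ℂ[X] →+* (MvPolynomial (Option ι) ℂ ⧸ I) := (Ideal.Quotient.mk I).comp f0
  have hfin : f.FinitePresentation := by
    apply RingHom.FinitePresentation.of_finiteType.mp
    apply RingHom.FiniteType.of_comp_finiteType (f := (Polynomial.C : ℂ →+* ℂ[X]))
    have : f.comp Polynomial.C = algebraMap ℂ (MvPolynomial (Option ι) ℂ ⧸ I) := by
      ext z; simp [f, f0]; rfl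
    rw [this]
    exact RingHom.finiteType_algebraMap.mpr inferInstance
  have hev : ∀ (y : Option ι → ℂ) (d : ℂ[X]), MvPolynomial.eval y (f0 d) = d.eval (y none) := by
    intro y d
    induction d using Polynomial.induction_on' with
    | add p q hp hq => simp [map_add, hp, hq]
    | monomial n a => simp [f0, Polynomial.aeval_monomial]
  have hIle : ∀ y : Option ι → ℂ, (∀ j, MvPolynomial.eval y (F j) = 0) → I ≤ RingHom.ker (MvPolynomial.eval y) := by
    intro y hy
    rw [hI, Ideal.span_le]
    rintro _ ⟨j, rfl⟩
    exact hy j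
  have hinj : Function.Injective f := by
    rw [injective_iff_map_eq_zero]
    intro d hd
    have hd' : f0 d ∈ I := Ideal.Quotient.eq_zero_iff_mem.mp hd
    apply Polynomial.eq_zero_of_infinite_isRoot
    refine hinf.mono ?_
    rintro t ⟨x, hx⟩
    have := hIle _ hx hd'
    rw [RingHom.mem_ker, hev] at this
    exact this
  have hbot : (⊥ : PrimeSpectrum ℂ[X]) ∈ Set.range (PrimeSpectrum.comap f) := by
    obtain ⟨q, hq, hq2⟩ := Ideal.exists_comap_eq_of_mem_minimalPrimes_of_injective hinj (⊥ : Ideal ℂ[X])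
      (by rw [IsDomain.minimalPrimes_eq_singleton_bot]; rfl)
    exact ⟨⟨q, hq⟩, PrimeSpectrum.ext hq2⟩
  have hgen : ∀ V : Set (PrimeSpectrum ℂ[X]), IsOpen V → V.Nonempty → ⊥ ∈ V := by
    rintro V hV ⟨x, hx⟩
    exact hV.stableUnderGeneralization ((PrimeSpectrum.le_iff_specializes _ _).mp bot_le) hx
  obtain ⟨U, hU, ⟨x, hx⟩, hUs⟩ : ∃ U : Set (PrimeSpectrum ℂ[X]), IsOpen U ∧ U.Nonempty ∧
      U ⊆ Set.range (PrimeSpectrum.comap f) := by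
    rcases constr_generic ⊥ hgen _ (PrimeSpectrum.isConstructible_range_comap hfin) with h | ⟨U, hU, hn, hs⟩
    · exact h
    · exact absurd hbot (hs (hgen U hU hn))
  obtain ⟨_, ⟨d, rfl⟩, hd, hdU⟩ := PrimeSpectrum.isTopologicalBasis_basic_opens.exists_subset_of_mem_open hx hU
  have hd0 : d ≠ 0 := by
    rintro rfl
    simp at hd
  refine (Polynomial.finite_setOfPred_isRoot hd0).subset ?_
  intro t ht
  by_contra hroot
  apply ht
  -- the prime (X - t)
  let P : PrimeSpectrum ℂ[X] := ⟨RingHom.ker (Polynomial.evalRingHom t), RingHom.ker_isPrime _⟩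
  have hP : P ∈ (PrimeSpectrum.basicOpen d : Set (PrimeSpectrum ℂ[X])) := by
    intro h
    exact hroot h
  obtain ⟨q, hq⟩ := hUs (hdU hP)
  have hqp := q.2
  let J : Ideal (MvPolynomial (Option ι) ℂ) := Ideal.comap (Ideal.Quotient.mk I) q.asIdeal
  have hJ : J ≠ ⊤ := (Ideal.IsPrime.comap (Ideal.Quotient.mk I)).ne_top
  obtain ⟨M, hM, hJM⟩ := Ideal.exists_le_maximal J hJ
  obtain ⟨y, hy⟩ := MvPolynomial.isMaximal_iff_eq_vanishingIdeal_singleton.mp hM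
  have hmem : ∀ g ∈ J, MvPolynomial.eval y g = 0 := by
    intro g hg
    have := hJM hg
    rw [hy] at this
    simpa [MvPolynomial.aeval_def] using this
  have hyt : y none = t := by
    have h1 : (Polynomial.X - Polynomial.C t) ∈ P.asIdeal := by
      simp [P, RingHom.mem_ker]
    rw [← hq] at h1
    have := hmem (f0 (Polynomial.X - Polynomial.C t)) h1
    rw [hev] at this
    simpa [sub_eq_zero] using this
  refine ⟨fun i => y (some i), fun j => ?_⟩
  have h2 : F j ∈ J := by
    have : Ideal.Quotient.mk I (F j) = 0 := Ideal.Quotient.eq_zero_iff_mem.mpr (Ideal.subset_span ⟨j, rfl⟩)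
    show Ideal.Quotient.mk I (F j) ∈ q.asIdeal
    rw [this]; exact zero_mem _
  have h3 := hmem _ h2
  have h4 : (fun o : Option ι => o.elim t (fun i => y (some i))) = y := by
    funext o; cases o <;> simp [hyt]
  rw [h4]; exact h3

end

section
lemma mvpoly_contDiff {σ : Type} [Fintype σ] (p : MvPolynomial σ ℂ) :
    ContDiff ℂ 1 (fun y : σ → ℂ => MvPolynomial.eval y p) := by
  induction p using MvPolynomial.induction_on with
  | C a => simp; exact contDiff_const
  | add p q hp hq => simp only [map_add]; exact hp.add hq
  | mul_X p i hp => simp only [map_mul, MvPolynomial.eval_X]; exact hp.mul (contDiff_apply ℂ ℂ i)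

lemma solv_cofinite {ι τ : Type} [Fintype ι] [Fintype τ] (F : τ → MvPolynomial (Option ι) ℂ)
    (L : (ι → ℂ) →ₗ[ℂ] (τ → ℂ)) (hL : Function.Surjective L)
    (hFL : ∀ x j, MvPolynomial.eval (fun o : Option ι => o.elim 0 x) (F j) = L x j) :
    {t : ℂ | ∃ x : ι → ℂ, ∀ j, MvPolynomial.eval (fun o => o.elim t x) (F j) = 0}ᶜ.Finite := by
  apply cofinite_of_infinite
  let g : ℂ × (ι → ℂ) → (τ → ℂ) := fun z j => MvPolynomial.eval (fun o => o.elim z.1 z.2) (F j)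
  have hg : ContDiff ℂ 1 g := by
    rw [contDiff_pi]
    intro j
    refine (mvpoly_contDiff (F j)).comp ?_
    rw [contDiff_pi]
    rintro (_ | i)
    · exact contDiff_fst
    · exact (contDiff_apply ℂ ℂ i).comp contDiff_snd
  have hg0 : HasStrictFDerivAt g (fderiv ℂ g 0) 0 := hg.contDiffAt.hasStrictFDerivAt (by simp)
  have hgL : ∀ w, fderiv ℂ g 0 (0, w) = L w := by
    intro w
    have h1 : HasDerivAt (fun s : ℂ => s • ((0 : ℂ), w)) ((0 : ℂ), w) 0 := by
      simpa using (hasDerivAt_id (0 : ℂ)).smul_const ((0 : ℂ), w)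
    have h2 : HasFDerivAt g (fderiv ℂ g 0) ((0 : ℂ) • ((0 : ℂ), w)) := by
      rw [zero_smul]; exact hg0.hasFDerivAt
    have h3 := h2.comp_hasDerivAt (0 : ℂ) h1
    have h4 : (g ∘ fun s : ℂ => s • ((0 : ℂ), w)) = fun s : ℂ => s • L w := by
      funext s j
      simp only [Function.comp, g, Prod.smul_mk, smul_zero]
      rw [hFL, map_smul]
    rw [h4] at h3
    have h5 : HasDerivAt (fun s : ℂ => s • L w) (L w) 0 := by
      simpa using (hasDerivAt_id (0 : ℂ)).smul_const (L w)
    exact h3.unique h5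
  let h : ℂ × (ι → ℂ) → ℂ × (τ → ℂ) := fun z => (z.1, g z)
  have hh : HasStrictFDerivAt h ((ContinuousLinearMap.fst ℂ ℂ (ι → ℂ)).prod (fderiv ℂ g 0)) 0 :=
    (hasStrictFDerivAt_fst).prodMk hg0
  have hsurj : ((ContinuousLinearMap.fst ℂ ℂ (ι → ℂ)).prod (fderiv ℂ g 0)).range = ⊤ := by
    rw [LinearMap.range_eq_top]
    rintro ⟨a, y⟩
    obtain ⟨w, hw⟩ := hL (y - fderiv ℂ g 0 (a, 0))
    refine ⟨(a, w), ?_⟩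
    have : ((a, w) : ℂ × (ι → ℂ)) = (a, 0) + (0, w) := by simp
    ext1
    · simp
    · simp only [ContinuousLinearMap.coe_coe, ContinuousLinearMap.prod_apply]
      rw [this, map_add, hgL, hw]; simp
  have hmap := hh.map_nhds_eq_of_surj hsurj
  have h0 : h 0 = 0 := by
    ext1
    · simp [h]
    · funext j
      simp only [h, g]
      have := hFL 0 j
      simpa using this
  rw [h0] at hmap
  have hev : ∀ᶠ t in nhds (0 : ℂ), ∃ x : ι → ℂ, ∀ j, MvPolynomial.eval (fun o => o.elim t x) (F j) = 0 := by
    have : Set.range h ∈ nhds (0 : ℂ × (τ → ℂ)) := by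
      rw [← hmap]
      exact Filter.mem_map.mpr (by simp)
    have hc : Filter.Tendsto (fun t : ℂ => (t, (0 : τ → ℂ))) (nhds 0) (nhds 0) := by
      have : Continuous (fun t : ℂ => (t, (0 : τ → ℂ))) := by fun_prop
      exact this.tendsto 0
    filter_upwards [hc this] with t ht
    obtain ⟨⟨a, x⟩, hx⟩ := ht
    simp only [h, Prod.mk.injEq] at hx
    obtain ⟨rfl, hx⟩ := hx
    exact ⟨x, fun j => congrFun hx j⟩
  exact infinite_of_mem_nhds 0 hev

end

section
open Matrix

/-- unknowns of the incidence system -/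
abbrev SIdx {κ lam : Type} (α : Fin 3 → κ → ℝ) (β : Fin 3 → lam → ℝ) : Type :=
  (lam × κ) ⊕ {x : Fin 3 × lam × κ // α x.1 x.2.2 ≤ β x.1 x.2.1}

lemma trace_quad {κ lam : Type} [Fintype κ] [Fintype lam] [DecidableEq κ] [DecidableEq lam]
    (N : Matrix lam lam ℝ) (φ : Matrix lam κ ℝ) :
    trace (φᵀ * N * φ) = ∑ v, (φ.col v) ⬝ᵥ (N *ᵥ (φ.col v)) := by
  simp only [trace, diag_apply, Matrix.mul_assoc]
  refine Finset.sum_congr rfl fun v _ => ?_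
  rw [Matrix.mul_apply']
  rfl

lemma hom_zero {κ lam : Type} [Fintype κ] [Fintype lam] [DecidableEq κ] [DecidableEq lam]
    (α : Fin 3 → κ → ℝ) (β : Fin 3 → lam → ℝ)
    (P : Fin 3 → Matrix κ κ ℝ) (R : Fin 3 → Matrix lam lam ℝ)
    (hP : ∀ s, (P s)ᵀ * P s = 1) (hR : ∀ s, (R s)ᵀ * R s = 1) (μ : ℝ)
    (h1 : ∑ s, P s * diagonal (α s) * (P s)ᵀ = μ • (1 : Matrix κ κ ℝ))
    (h2 : (μ • (1 : Matrix lam lam ℝ) - ∑ s, R s * diagonal (β s) * (R s)ᵀ).PosDef)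
    (φ : Matrix lam κ ℝ) (ψ : Fin 3 → Matrix lam κ ℝ)
    (hψ : ∀ s q v, β s q < α s v → ψ s q v = 0) (he : ∀ s, R s * ψ s = φ * P s) : φ = 0 := by
  have hP' : ∀ s, P s * (P s)ᵀ = 1 := fun s => mul_eq_one_comm.mp (hP s)
  have hφ : ∀ s, φ = R s * ψ s * (P s)ᵀ := by
    intro s; rw [he, Matrix.mul_assoc, hP', Matrix.mul_one]
  have key : ∀ s, 0 ≤ trace (φᵀ * (R s * diagonal (β s) * (R s)ᵀ) * φ)
      - trace (φᵀ * φ * (P s * diagonal (α s) * (P s)ᵀ)) := by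
    intro s
    have e1 : trace (φᵀ * (R s * diagonal (β s) * (R s)ᵀ) * φ) = trace ((ψ s)ᵀ * diagonal (β s) * ψ s) := by
      have : φᵀ * (R s * diagonal (β s) * (R s)ᵀ) * φ
          = P s * ((ψ s)ᵀ * (((R s)ᵀ * R s) * (diagonal (β s) * (((R s)ᵀ * R s) * ψ s)))) * (P s)ᵀ := by
        rw [hφ s]
        simp only [transpose_mul, transpose_transpose, Matrix.mul_assoc]
      rw [this, trace_mul_comm, ← Matrix.mul_assoc, hP, hR]
      simp only [Matrix.one_mul, Matrix.mul_assoc]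
    have e2 : trace (φᵀ * φ * (P s * diagonal (α s) * (P s)ᵀ)) = trace ((ψ s)ᵀ * ψ s * diagonal (α s)) := by
      have : φᵀ * φ * (P s * diagonal (α s) * (P s)ᵀ)
          = P s * ((ψ s)ᵀ * (((R s)ᵀ * R s) * (ψ s * (((P s)ᵀ * P s) * diagonal (α s))))) * (P s)ᵀ := by
        rw [hφ s]
        simp only [transpose_mul, transpose_transpose, Matrix.mul_assoc]
      rw [this, trace_mul_comm, ← Matrix.mul_assoc, hP, hR]
      simp only [Matrix.one_mul, Matrix.mul_assoc]
    rw [e1, e2]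
    have e3 : trace ((ψ s)ᵀ * diagonal (β s) * ψ s) - trace ((ψ s)ᵀ * ψ s * diagonal (α s))
        = ∑ v, ∑ q, (ψ s q v) ^ 2 * (β s q - α s v) := by
      simp only [trace, diag_apply, Matrix.mul_assoc, ← Finset.sum_sub_distrib]
      refine Finset.sum_congr rfl fun v _ => ?_
      simp only [Matrix.mul_apply (M := (ψ s)ᵀ), diagonal_mul, mul_diagonal, transpose_apply, ← Finset.sum_sub_distrib]
      refine Finset.sum_congr rfl fun q _ => ?_
      ring
    rw [e3]
    refine Finset.sum_nonneg fun v _ => Finset.sum_nonneg fun q _ => ?_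
    by_cases h : β s q < α s v
    · rw [hψ s q v h]; simp
    · exact mul_nonneg (sq_nonneg _) (by linarith [not_lt.mp h])
  have hsum : 0 ≤ trace (φᵀ * (∑ s, R s * diagonal (β s) * (R s)ᵀ) * φ) - μ * trace (φᵀ * φ) := by
    have h3 : μ * trace (φᵀ * φ) = trace (φᵀ * φ * ∑ s, P s * diagonal (α s) * (P s)ᵀ) := by
      rw [h1]; simp
    rw [h3, Matrix.mul_sum, Matrix.mul_sum, Matrix.sum_mul, trace_sum, trace_sum, ← Finset.sum_sub_distrib]
    exact Finset.sum_nonneg fun s _ => key s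
  have hneg : trace (φᵀ * (μ • (1 : Matrix lam lam ℝ) - ∑ s, R s * diagonal (β s) * (R s)ᵀ) * φ) ≤ 0 := by
    rw [Matrix.mul_sub, Matrix.sub_mul, trace_sub]
    have : trace (φᵀ * (μ • (1 : Matrix lam lam ℝ)) * φ) = μ * trace (φᵀ * φ) := by simp
    rw [this]; linarith
  rw [trace_quad] at hneg
  have hnn : ∀ v ∈ Finset.univ, 0 ≤ (φ.col v) ⬝ᵥ ((μ • (1 : Matrix lam lam ℝ) - ∑ s, R s * diagonal (β s) * (R s)ᵀ) *ᵥ (φ.col v)) := by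
    intro v _
    simpa using h2.posSemidef.dotProduct_mulVec_nonneg (φ.col v)
  have hz := (Finset.sum_eq_zero_iff_of_nonneg hnn).mp (le_antisymm hneg (Finset.sum_nonneg hnn))
  ext q v
  by_contra hne
  have hcol : φ.col v ≠ 0 := fun h => hne (congrFun h q)
  have := h2.dotProduct_mulVec_pos hcol
  simp only [star_trivial] at this
  rw [hz v (Finset.mem_univ v)] at this
  exact lt_irrefl _ this

section sys
variable {κ lam : Type} [Fintype κ] [Fintype lam] [DecidableEq κ] [DecidableEq lam]
  (α : Fin 3 → κ → ℝ) (β : Fin 3 → lam → ℝ)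

noncomputable def sPhi {S : Type} (x : SIdx α β → S) : Matrix lam κ S := fun q v => x (Sum.inl (q, v))

open Classical in
noncomputable def sPsi {S : Type} [Zero S] (x : SIdx α β → S) (s : Fin 3) : Matrix lam κ S :=
  fun q v => if h : α s v ≤ β s q then x (Sum.inr ⟨(s, q, v), h⟩) else 0

noncomputable def sysF {S : Type} [CommRing S] [Algebra ℂ S] (G0 G1 : Matrix (κ ⊕ lam) (κ ⊕ lam) ℂ)
    (t : S) (x : SIdx α β → S) (s : Fin 3) : Matrix lam κ S :=
  fromCols (-sPhi α β x) (1 : Matrix lam lam S) * ((1 - t) • G0.map (algebraMap ℂ S) + t • G1.map (algebraMap ℂ S)) *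
    fromRows (1 : Matrix κ κ S) (sPsi α β x s)

lemma sysF_map {S S' : Type} [CommRing S] [Algebra ℂ S] [CommRing S'] [Algebra ℂ S'] (f : S →ₐ[ℂ] S')
    (G0 G1 : Matrix (κ ⊕ lam) (κ ⊕ lam) ℂ) (t : S) (x : SIdx α β → S) (s : Fin 3) :
    (sysF α β G0 G1 t x s).map f = sysF α β G0 G1 (f t) (f ∘ x) s := by
  unfold sysF
  rw [Matrix.map_mul, Matrix.map_mul]
  congr 1
  · congr 1
    · ext i j
      rcases j with j | j
      · simp [sPhi]
      · simp [Matrix.one_apply, apply_ite f]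
    · ext i j; simp
  · ext i j
    rcases i with i | i
    · simp [Matrix.one_apply, apply_ite f]
    · simp only [map_apply, fromRows_apply_inr, sPsi, Function.comp]
      split_ifs <;> simp

end sys

open Classical in
lemma card_SIdx {κ lam : Type} [Fintype κ] [Fintype lam] (α : Fin 3 → κ → ℝ) (β : Fin 3 → lam → ℝ)
    (hc : Fintype.card {x : Fin 3 × lam × κ // β x.1 x.2.1 < α x.1 x.2.2} ≤ Fintype.card lam * Fintype.card κ) :
    Fintype.card (Fin 3 × lam × κ) ≤ Fintype.card (SIdx α β) := by
  have h := Fintype.card_subtype_compl (fun x : Fin 3 × lam × κ => β x.1 x.2.1 < α x.1 x.2.2)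
  simp only [not_lt] at h
  rw [Fintype.card_sum, h, Fintype.card_prod lam κ]
  omega

open Classical in
lemma sys_cofinite {κ lam : Type} [Fintype κ] [Fintype lam] [DecidableEq κ] [DecidableEq lam]
    (α : Fin 3 → κ → ℝ) (β : Fin 3 → lam → ℝ)
    (P : Fin 3 → Matrix κ κ ℝ) (R : Fin 3 → Matrix lam lam ℝ)
    (hP : ∀ s, (P s)ᵀ * P s = 1) (hR : ∀ s, (R s)ᵀ * R s = 1) (μ : ℝ)
    (h1 : ∑ s, P s * diagonal (α s) * (P s)ᵀ = μ • (1 : Matrix κ κ ℝ))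
    (h2 : (μ • (1 : Matrix lam lam ℝ) - ∑ s, R s * diagonal (β s) * (R s)ᵀ).PosDef)
    (hc : Fintype.card {x : Fin 3 × lam × κ // β x.1 x.2.1 < α x.1 x.2.2} ≤ Fintype.card lam * Fintype.card κ)
    (G1 : Fin 3 → Matrix (κ ⊕ lam) (κ ⊕ lam) ℂ) :
    {t : ℂ | ∃ φ : Matrix lam κ ℂ, ∃ ψ : Fin 3 → Matrix lam κ ℂ,
      (∀ s q v, β s q < α s v → ψ s q v = 0) ∧
      ∀ s, fromCols (-φ) (1 : Matrix lam lam ℂ) * ((1 - t) • fromBlocks ((P s).map Complex.ofReal) 0 0 ((R s).map Complex.ofReal) + t • G1 s) *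
        fromRows (1 : Matrix κ κ ℂ) (ψ s) = 0}ᶜ.Finite := by
  set G0 : Fin 3 → Matrix (κ ⊕ lam) (κ ⊕ lam) ℂ := fun s =>
    fromBlocks ((P s).map Complex.ofReal) 0 0 ((R s).map Complex.ofReal) with hG0
  let F : (Fin 3 × lam × κ) → MvPolynomial (Option (SIdx α β)) ℂ := fun j =>
    sysF α β (G0 j.1) (G1 j.1) (MvPolynomial.X none) (fun i => MvPolynomial.X (some i)) j.1 j.2.1 j.2.2
  have hF : ∀ (t : ℂ) (x : SIdx α β → ℂ) (j), MvPolynomial.eval (fun o : Option (SIdx α β) => o.elim t x) (F j)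
      = sysF α β (G0 j.1) (G1 j.1) t x j.1 j.2.1 j.2.2 := by
    intro t x j
    have := sysF_map α β (MvPolynomial.aeval (R := ℂ) (fun o : Option (SIdx α β) => o.elim t x)) (G0 j.1) (G1 j.1)
      (MvPolynomial.X none) (fun i => MvPolynomial.X (some i)) j.1
    have e1 : (MvPolynomial.aeval (R := ℂ) (fun o : Option (SIdx α β) => o.elim t x)) (MvPolynomial.X none) = t := by simp
    have e2 : (MvPolynomial.aeval (R := ℂ) (fun o : Option (SIdx α β) => o.elim t x)) ∘ (fun i => MvPolynomial.X (some i)) = x := by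
      funext i; simp
    rw [e1, e2] at this
    have h := congrFun (congrFun this j.2.1) j.2.2
    simp only [map_apply] at h
    rw [← MvPolynomial.coe_aeval_eq_eval]
    simp only [F]
    exact h
  let L : (SIdx α β → ℂ) →ₗ[ℂ] ((Fin 3 × lam × κ) → ℂ) :=
    { toFun := fun x j => ((R j.1).map Complex.ofReal * sPsi α β x j.1 - sPhi α β x * (P j.1).map Complex.ofReal) j.2.1 j.2.2
      map_add' := by
        intro x y; funext j
        have e1 : sPsi α β (x + y) j.1 = sPsi α β x j.1 + sPsi α β y j.1 := by
          ext q v; simp only [sPsi, Matrix.add_apply]; split_ifs <;> simp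
        have e2 : sPhi α β (x + y) = sPhi α β x + sPhi α β y := by ext q v; simp [sPhi]
        simp only [e1, e2, Matrix.mul_add, Matrix.add_mul, Matrix.sub_apply, Matrix.add_apply, Pi.add_apply]
        ring
      map_smul' := by
        intro c x; funext j
        have e1 : sPsi α β (c • x) j.1 = c • sPsi α β x j.1 := by
          ext q v; simp only [sPsi, Matrix.smul_apply]; split_ifs <;> simp
        have e2 : sPhi α β (c • x) = c • sPhi α β x := by ext q v; simp [sPhi]
        simp only [e1, e2, Matrix.mul_smul, Matrix.smul_mul, Matrix.sub_apply, Matrix.smul_apply, Pi.smul_apply, RingHom.id_apply, smul_sub] }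
  have hFL : ∀ x j, MvPolynomial.eval (fun o : Option (SIdx α β) => o.elim 0 x) (F j) = L x j := by
    intro x j
    rw [hF]
    have : sysF α β (G0 j.1) (G1 j.1) (0 : ℂ) x j.1
      = (R j.1).map Complex.ofReal * sPsi α β x j.1 - sPhi α β x * (P j.1).map Complex.ofReal := by
      unfold sysF
      simp only [sub_zero, one_smul, zero_smul, add_zero, Algebra.algebraMap_self]
      have : (G0 j.1).map (RingHom.id ℂ) = G0 j.1 := by ext; simp
      rw [this, hG0, fromCols_mul_fromBlocks, fromCols_mul_fromRows]
      simp
      abel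
    rw [this]; rfl
  have hinj : Function.Injective L := by
    rw [injective_iff_map_eq_zero]
    intro x hx
    have hx' : ∀ s, (R s).map Complex.ofReal * sPsi α β x s = sPhi α β x * (P s).map Complex.ofReal := by
      intro s
      ext q v
      have := congrFun hx (s, q, v)
      exact sub_eq_zero.mp this
    have hsupp : ∀ s q v, β s q < α s v → sPsi α β x s q v = 0 := by
      intro s q v h
      simp [sPsi, not_le.mpr h]
    have hre : (sPhi α β x).map Complex.re = 0 := by
      refine hom_zero α β P R hP hR μ h1 h2 _ (fun s => (sPsi α β x s).map Complex.re) ?_ ?_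
      · intro s q v h; simp [hsupp s q v h]
      · intro s
        ext q v
        have := congrArg Complex.re (congrFun (congrFun (hx' s) q) v)
        simpa [Matrix.mul_apply] using this
    have him : (sPhi α β x).map Complex.im = 0 := by
      refine hom_zero α β P R hP hR μ h1 h2 _ (fun s => (sPsi α β x s).map Complex.im) ?_ ?_
      · intro s q v h; simp [hsupp s q v h]
      · intro s
        ext q v
        have := congrArg Complex.im (congrFun (congrFun (hx' s) q) v)
        simpa [Matrix.mul_apply] using this
    have hphi : sPhi α β x = 0 := by
      ext q v
      apply Complex.ext
      · exact congrFun (congrFun hre q) v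
      · exact congrFun (congrFun him q) v
    have hpsi : ∀ s, sPsi α β x s = 0 := by
      intro s
      have h := hx' s
      rw [hphi, Matrix.zero_mul] at h
      have h3 : ((R s)ᵀ).map Complex.ofReal * (R s).map Complex.ofReal = 1 := by
        ext i j
        have h4 := congrArg Complex.ofReal (congrFun (congrFun (hR s) i) j)
        rw [Matrix.mul_apply] at h4 ⊢
        rw [Matrix.one_apply] at h4 ⊢
        push_cast at h4
        simp only [map_apply]
        rw [h4]
        split_ifs <;> simp
      calc sPsi α β x s = (((R s)ᵀ).map Complex.ofReal * (R s).map Complex.ofReal) * sPsi α β x s := by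
            rw [h3, Matrix.one_mul]
        _ = 0 := by rw [Matrix.mul_assoc, h, Matrix.mul_zero]
    funext i
    rcases i with ⟨q, v⟩ | ⟨⟨s, q, v⟩, h⟩
    · exact congrFun (congrFun hphi q) v
    · have := congrFun (congrFun (hpsi s) q) v
      simp only [sPsi] at this
      rw [dif_pos h] at this
      exact this
  have hsurj : Function.Surjective L := by
    have h5 := LinearMap.finrank_le_finrank_of_injective hinj
    have h6 := card_SIdx α β hc
    rw [Module.finrank_pi, Module.finrank_pi] at h5
    exact (LinearMap.injective_iff_surjective_of_finrank_eq_finrank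
      (by rw [Module.finrank_pi, Module.finrank_pi]; omega)).mp hinj
  refine (solv_cofinite F L hsurj hFL).subset ?_
  apply Set.compl_subset_compl.mpr
  rintro t ⟨x, hx⟩
  refine ⟨sPhi α β x, sPsi α β x, ?_, ?_⟩
  · intro s q v h
    simp [sPsi, not_le.mpr h]
  · intro s
    ext q v
    have := hx (s, q, v)
    rw [hF] at this
    simp only [sysF, Algebra.algebraMap_self] at this
    have e1 : (G0 s).map (RingHom.id ℂ) = G0 s := by ext; simp
    have e2 : (G1 s).map (RingHom.id ℂ) = G1 s := by ext; simp
    rw [e1, e2] at this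
    exact this

end

section
open Matrix

lemma gs_sorted {V κ : Type} [NormedAddCommGroup V] [InnerProductSpace ℂ V] [Fintype κ]
    (α : κ → ℝ) (w : κ → V) (hw : LinearIndependent ℂ w) :
    ∃ u : κ → V, Orthonormal ℂ u ∧ ∀ v, u v ∈ Submodule.span ℂ (w '' {v' | α v ≤ α v'}) := by
  classical
  let e0 := (Fintype.equivFin κ).symm
  let e : Fin (Fintype.card κ) ≃ κ := (Tuple.sort (fun i => - α (e0 i))).trans e0
  have hmono : Monotone (fun i => - α (e i)) := Tuple.monotone_sort (fun i => - α (e0 i))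
  have hwe : LinearIndependent ℂ (w ∘ e) := hw.comp e e.injective
  have ho := InnerProductSpace.gramSchmidtNormed_orthonormal (𝕜 := ℂ) hwe
  refine ⟨fun v => InnerProductSpace.gramSchmidtNormed ℂ (w ∘ e) (e.symm v), ho.comp e.symm e.symm.injective, ?_⟩
  intro v
  have h1 : InnerProductSpace.gramSchmidtNormed ℂ (w ∘ e) (e.symm v) ∈ Submodule.span ℂ ((w ∘ e) '' Set.Iic (e.symm v)) := by
    unfold InnerProductSpace.gramSchmidtNormed
    exact Submodule.smul_mem _ _ (InnerProductSpace.gramSchmidt_mem_span ℂ (w ∘ e) le_rfl)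
  refine Submodule.span_mono ?_ h1
  rintro _ ⟨i, hi, rfl⟩
  refine ⟨e i, ?_, rfl⟩
  have := hmono (Set.mem_Iic.mp hi)
  simp only [Equiv.apply_symm_apply] at this
  simp only [Set.mem_ofPred_eq]
  linarith

/-- matrix form -/
lemma gs_matrix {I κ : Type} [Fintype I] [Fintype κ] [DecidableEq κ]
    (α : κ → ℝ) (W : Matrix I κ ℂ) (hW : ∀ x, W *ᵥ x = 0 → x = 0) :
    ∃ Y : Matrix κ κ ℂ, (W * Y)ᴴ * (W * Y) = 1 ∧ ∀ v' v, α v' < α v → Y v' v = 0 := by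
  classical
  let w : κ → EuclideanSpace ℂ I := fun v => WithLp.toLp 2 (W.col v)
  have hsum : ∀ x : κ → ℂ, ∑ v, x v • w v = WithLp.toLp 2 (W *ᵥ x) := by
    intro x
    ext i
    simp [w, Matrix.mulVec, dotProduct, mul_comm]
  have hw : LinearIndependent ℂ w := by
    rw [Fintype.linearIndependent_iff]
    intro g hg
    rw [hsum] at hg
    have := hW g (by simpa using congrArg (WithLp.ofLp) hg)
    intro i; rw [this]; rfl
  obtain ⟨u, hu, hs⟩ := gs_sorted α w hw
  have hY : ∀ v, ∃ y : κ → ℂ, (∀ v', α v' < α v → y v' = 0) ∧ u v = WithLp.toLp 2 (W *ᵥ y) := by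
    intro v
    refine Submodule.span_induction (p := fun z _ => ∃ y : κ → ℂ, (∀ v', α v' < α v → y v' = 0) ∧ z = WithLp.toLp 2 (W *ᵥ y)) ?_ ?_ ?_ ?_ (hs v)
    · rintro _ ⟨v', hv', rfl⟩
      refine ⟨Pi.single v' 1, ?_, ?_⟩
      · intro v'' h
        have : v'' ≠ v' := by
          rintro rfl
          exact absurd hv' (not_le.mpr h)
        simp [this]
      · simp [w]
    · exact ⟨0, by simp, by simp⟩
    · rintro _ _ _ _ ⟨y1, h1, rfl⟩ ⟨y2, h2, rfl⟩
      refine ⟨y1 + y2, ?_, ?_⟩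
      · intro v' h; simp [h1 v' h, h2 v' h]
      · rw [Matrix.mulVec_add]; rfl
    · rintro a _ _ ⟨y1, h1, rfl⟩
      refine ⟨a • y1, ?_, ?_⟩
      · intro v' h; simp [h1 v' h]
      · rw [Matrix.mulVec_smul]; rfl
  choose y hy1 hy2 using hY
  refine ⟨Matrix.of (fun v' v => y v v'), ?_, ?_⟩
  · ext i j
    have h := (orthonormal_iff_ite.mp hu) i j
    rw [hy2 i, hy2 j] at h
    rw [Matrix.one_apply, ← h]
    simp only [Matrix.mul_apply, conjTranspose_apply, PiLp.inner_apply, RCLike.inner_apply, Matrix.mulVec, dotProduct, of_apply]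
    refine Finset.sum_congr rfl fun k _ => ?_
    rw [mul_comm]
    rfl
  · intro v' v h
    exact hy1 v v' h

/-- frames at a solvable parameter -/
lemma frames_exist {κ lam : Type} [Fintype κ] [Fintype lam] [DecidableEq κ] [DecidableEq lam]
    (α : Fin 3 → κ → ℝ) (β : Fin 3 → lam → ℝ) (G : Fin 3 → Matrix (κ ⊕ lam) (κ ⊕ lam) ℂ)
    (hG : ∀ s, (G s).det ≠ 0) (φ : Matrix lam κ ℂ) (ψ : Fin 3 → Matrix lam κ ℂ)
    (hψ : ∀ s q v, β s q < α s v → ψ s q v = 0)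
    (h : ∀ s, fromCols (-φ) (1 : Matrix lam lam ℂ) * G s * fromRows (1 : Matrix κ κ ℂ) (ψ s) = 0) :
    ∃ U : Fin 3 → Matrix (κ ⊕ lam) κ ℂ, (∀ s, (U s)ᴴ * U s = 1) ∧ (∀ s, U s * (U s)ᴴ = U 0 * (U 0)ᴴ) ∧
      ∀ s k v, Sum.elim (α s) (β s) k < α s v → ((G s).adjugate * U s) k v = 0 := by
  have hW : ∀ s x, (G s * fromRows (1 : Matrix κ κ ℂ) (ψ s)) *ᵥ x = 0 → x = 0 := by
    intro s x hx
    rw [← Matrix.mulVec_mulVec] at hx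
    have := Matrix.eq_zero_of_mulVec_eq_zero (hG s) hx
    rw [fromRows_mulVec] at this
    funext i
    have h2 := congrFun this (Sum.inl i)
    simpa using h2
  choose Y hY1 hY2 using fun s => gs_matrix (α s) _ (hW s)
  have hrow : ∀ s, G s * fromRows (1 : Matrix κ κ ℂ) (ψ s) =
      fromRows (1 : Matrix κ κ ℂ) φ * (G s * fromRows (1 : Matrix κ κ ℂ) (ψ s)).toRows₁ := by
    intro s
    have h' := h s
    rw [Matrix.mul_assoc] at h'
    generalize G s * fromRows (1 : Matrix κ κ ℂ) (ψ s) = M at h' ⊢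
    rw [← fromRows_toRows M, fromCols_mul_fromRows] at h'
    rw [fromRows_mul]
    nth_rw 1 [← fromRows_toRows M]
    congr 1
    · simp
    · have : φ * M.toRows₁ = M.toRows₂ := by
        rw [Matrix.neg_mul, Matrix.one_mul] at h'
        exact (neg_add_eq_zero.mp h')
      rw [this]
  set Z : Fin 3 → Matrix κ κ ℂ := fun s => (G s * fromRows (1 : Matrix κ κ ℂ) (ψ s)).toRows₁ * Y s with hZ
  have hU : ∀ s, G s * fromRows (1 : Matrix κ κ ℂ) (ψ s) * Y s = fromRows (1 : Matrix κ κ ℂ) φ * Z s := by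
    intro s
    rw [hZ]
    simp only
    rw [← Matrix.mul_assoc, ← hrow s]
  refine ⟨fun s => G s * fromRows (1 : Matrix κ κ ℂ) (ψ s) * Y s, hY1, ?_, ?_⟩
  · intro s
    have hinv : ∀ s, ((fromRows (1 : Matrix κ κ ℂ) φ * Z s)ᴴ * fromRows (1 : Matrix κ κ ℂ) φ) * Z s = 1 := by
      intro s
      rw [Matrix.mul_assoc, ← hU s]
      exact hY1 s
    have hinv0 := mul_eq_one_comm.mp (hinv 0)
    simp only [hU]
    have hs := hY1 s
    have h0 := hY1 0
    rw [hU] at hs h0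
    set U0 := fromRows (1 : Matrix κ κ ℂ) φ * Z 0 with hU0
    obtain ⟨C, hC⟩ : ∃ C : Matrix κ κ ℂ, fromRows (1 : Matrix κ κ ℂ) φ * Z s = U0 * C := by
      refine ⟨((fromRows (1 : Matrix κ κ ℂ) φ * Z 0)ᴴ * fromRows (1 : Matrix κ κ ℂ) φ) * Z s, ?_⟩
      rw [Matrix.mul_assoc (fromRows (1 : Matrix κ κ ℂ) φ) (Z 0), ← Matrix.mul_assoc (Z 0), hinv0, Matrix.one_mul]
    rw [hC] at hs ⊢
    have hCC : Cᴴ * C = 1 := by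
      rw [← hs, conjTranspose_mul, Matrix.mul_assoc, ← Matrix.mul_assoc U0ᴴ, h0, Matrix.one_mul]
    have hCC' := mul_eq_one_comm.mp hCC
    rw [conjTranspose_mul, Matrix.mul_assoc, ← Matrix.mul_assoc C, hCC', Matrix.one_mul]
  · intro s k v hk
    have e1 : (G s).adjugate * (G s * fromRows (1 : Matrix κ κ ℂ) (ψ s) * Y s)
        = (G s).det • (fromRows (1 : Matrix κ κ ℂ) (ψ s) * Y s) := by
      rw [Matrix.mul_assoc, ← Matrix.mul_assoc, adjugate_mul, Matrix.smul_mul, Matrix.one_mul]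
    rw [e1, Matrix.smul_apply]
    have : (fromRows (1 : Matrix κ κ ℂ) (ψ s) * Y s) k v = 0 := by
      rcases k with k | k
      · simp only [Sum.elim_inl] at hk
        rw [fromRows_mul, fromRows_apply_inl, Matrix.one_mul]
        exact hY2 s k v hk
      · simp only [Sum.elim_inr] at hk
        rw [fromRows_mul, fromRows_apply_inr, Matrix.mul_apply]
        refine Finset.sum_eq_zero fun v' _ => ?_
        by_cases h3 : α s v' < α s v
        · rw [hY2 s v' v h3, mul_zero]
        · rw [hψ s k v' (by linarith), zero_mul]
    rw [this, smul_zero]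

end

section
open Matrix Topology Filter

lemma entry_le {I κ : Type} [Fintype I] [Fintype κ] [DecidableEq κ] (U : Matrix I κ ℂ) (h : Uᴴ * U = 1) (i : I) (j : κ) :
    U i j ∈ Metric.closedBall (0 : ℂ) 1 := by
  have h1 := congrArg Complex.re (congrFun (congrFun h j) j)
  simp only [Matrix.mul_apply, conjTranspose_apply, Matrix.one_apply_eq, Complex.one_re, Complex.re_sum] at h1
  have h2 : ∀ k, (star (U k j) * U k j).re = ‖U k j‖ ^ 2 := by
    intro k
    rw [← Complex.normSq_eq_norm_sq, Complex.normSq_apply]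
    simp
  simp only [h2] at h1
  have h3 := Finset.single_le_sum (f := fun k => ‖U k j‖ ^ 2) (fun k _ => sq_nonneg _) (Finset.mem_univ i)
  simp only [h1] at h3
  rw [mem_closedBall_zero_iff]
  nlinarith [norm_nonneg (U i j)]

lemma compact_frames {I κ : Type} [Fintype I] [Fintype κ] [DecidableEq κ] :
    IsCompact {U : Fin 3 → Matrix I κ ℂ | ∀ s, (U s)ᴴ * U s = 1} := by
  have hK : IsCompact (Set.univ.pi fun _ : Fin 3 => Set.univ.pi fun _ : I => Set.univ.pi fun _ : κ => Metric.closedBall (0 : ℂ) 1) :=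
    isCompact_univ_pi fun _ => isCompact_univ_pi fun _ => isCompact_univ_pi fun _ => isCompact_closedBall _ _
  refine IsCompact.of_isClosed_subset hK ?_ ?_
  · have : {U : Fin 3 → Matrix I κ ℂ | ∀ s, (U s)ᴴ * U s = 1} = ⋂ s, {U : Fin 3 → Matrix I κ ℂ | (U s)ᴴ * U s = 1} := by
      ext; simp
    rw [this]
    refine isClosed_iInter fun s => isClosed_eq ?_ continuous_const
    fun_prop
  · intro U hU s _ i _ j _
    exact entry_le (U s) (hU s) i j

open Classical in
/-- frames for the end point -/
lemma frames_at_one {κ lam : Type} [Fintype κ] [Fintype lam] [DecidableEq κ] [DecidableEq lam]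
    (α : Fin 3 → κ → ℝ) (β : Fin 3 → lam → ℝ)
    (P : Fin 3 → Matrix κ κ ℝ) (R : Fin 3 → Matrix lam lam ℝ)
    (hP : ∀ s, (P s)ᵀ * P s = 1) (hR : ∀ s, (R s)ᵀ * R s = 1) (μ : ℝ)
    (h1 : ∑ s, P s * diagonal (α s) * (P s)ᵀ = μ • (1 : Matrix κ κ ℝ))
    (h2 : (μ • (1 : Matrix lam lam ℝ) - ∑ s, R s * diagonal (β s) * (R s)ᵀ).PosDef)
    (hc : Fintype.card {x : Fin 3 × lam × κ // β x.1 x.2.1 < α x.1 x.2.2} ≤ Fintype.card lam * Fintype.card κ)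
    (G1 : Fin 3 → Matrix (κ ⊕ lam) (κ ⊕ lam) ℂ) (hG : ∀ s, (G1 s).det ≠ 0) :
    ∃ U : Fin 3 → Matrix (κ ⊕ lam) κ ℂ, (∀ s, (U s)ᴴ * U s = 1) ∧ (∀ s, U s * (U s)ᴴ = U 0 * (U 0)ᴴ) ∧
      ∀ s k v, Sum.elim (α s) (β s) k < α s v → ((G1 s).adjugate * U s) k v = 0 := by
  have hfin := sys_cofinite α β P R hP hR μ h1 h2 hc G1
  let Gt : ℂ → Fin 3 → Matrix (κ ⊕ lam) (κ ⊕ lam) ℂ := fun t s =>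
    (1 - t) • fromBlocks ((P s).map Complex.ofReal) 0 0 ((R s).map Complex.ofReal) + t • G1 s
  have hGc : ∀ s, Continuous fun t => Gt t s := by
    intro s
    simp only [Gt]
    fun_prop
  have hG1 : Gt 1 = G1 := by funext s; simp [Gt]
  let Q : ℂ → (Fin 3 → Matrix (κ ⊕ lam) κ ℂ) → Prop := fun t U =>
    (∀ s, U s * (U s)ᴴ = U 0 * (U 0)ᴴ) ∧
      ∀ s k v, Sum.elim (α s) (β s) k < α s v → ((Gt t s).adjugate * U s) k v = 0
  let K : Set (ℂ × (Fin 3 → Matrix (κ ⊕ lam) κ ℂ)) :=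
    (Metric.closedBall (1 : ℂ) 1 ×ˢ {U : Fin 3 → Matrix (κ ⊕ lam) κ ℂ | ∀ s, (U s)ᴴ * U s = (1 : Matrix κ κ ℂ)}) ∩ {x | Q x.1 x.2}
  have hQ : IsClosed {x : ℂ × (Fin 3 → Matrix (κ ⊕ lam) κ ℂ) | Q x.1 x.2} := by
    have : {x : ℂ × (Fin 3 → Matrix (κ ⊕ lam) κ ℂ) | Q x.1 x.2} =
      (⋂ s, {x | x.2 s * (x.2 s)ᴴ = x.2 0 * (x.2 0)ᴴ}) ∩
      ⋂ s, ⋂ k, ⋂ v, ⋂ (_ : Sum.elim (α s) (β s) k < α s v), {x | ((Gt x.1 s).adjugate * x.2 s) k v = 0} := by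
      ext x; simp [Q]
    rw [this]
    refine IsClosed.inter (isClosed_iInter fun s => isClosed_eq (by fun_prop) (by fun_prop)) ?_
    refine isClosed_iInter fun s => isClosed_iInter fun k => isClosed_iInter fun v => isClosed_iInter fun _ => isClosed_eq ?_ continuous_const
    have c1 : Continuous fun x : ℂ × (Fin 3 → Matrix (κ ⊕ lam) κ ℂ) => (Gt x.1 s).adjugate * x.2 s := by
      have : Continuous fun x : ℂ × (Fin 3 → Matrix (κ ⊕ lam) κ ℂ) => (Gt x.1 s).adjugate :=
        ((hGc s).comp continuous_fst).matrix_adjugate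
      exact this.matrix_mul (by fun_prop)
    exact c1.matrix_elem k v
  have hKc : IsCompact K := ((isCompact_closedBall _ _).prod compact_frames).inter_right hQ
  have hcl : IsClosed (Prod.fst '' K) := (hKc.image continuous_fst).isClosed
  have hev : ∀ᶠ t in 𝓝[≠] (1 : ℂ), t ∈ Prod.fst '' K := by
    have ha := (Filter.le_cofinite_iff_eventually_ne.mpr (fun x => ?_) : 𝓝[≠] (1 : ℂ) ≤ cofinite) hfin.compl_mem_cofinite
    have hb : ∀ᶠ t in 𝓝[≠] (1 : ℂ), ∀ s, (Gt t s).det ≠ 0 := by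
      refine nhdsWithin_le_nhds ?_
      refine (Filter.eventually_all).mpr fun s => ?_
      refine ((hGc s).matrix_det.continuousAt).eventually_ne ?_
      rw [hG1]; exact hG s
    have hd : ∀ᶠ t in 𝓝[≠] (1 : ℂ), t ∈ Metric.closedBall (1 : ℂ) 1 :=
      nhdsWithin_le_nhds (Metric.closedBall_mem_nhds 1 one_pos)
    · filter_upwards [ha, hb, hd] with t hta htb htd
      rw [compl_compl] at hta
      obtain ⟨φ, ψ, hψ, he⟩ := hta
      obtain ⟨U, hU1, hU2, hU3⟩ := frames_exist α β (Gt t) htb φ ψ hψ he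
      exact ⟨(t, U), ⟨⟨htd, hU1⟩, hU2, hU3⟩, rfl⟩
    · by_cases hx : x = 1
      · subst hx; exact self_mem_nhdsWithin
      · exact nhdsWithin_le_nhds (isOpen_ne.mem_nhds (Ne.symm hx))
  have h1mem : (1 : ℂ) ∈ Prod.fst '' K := by
    have : (1 : ℂ) ∈ closure (Prod.fst '' K) := by
      rw [mem_closure_iff_frequently]
      exact (hev.frequently).filter_mono nhdsWithin_le_nhds
    rwa [hcl.closure_eq] at this
  obtain ⟨⟨t, U⟩, ⟨⟨_, hU1⟩, hU2, hU3⟩, ht⟩ := h1mem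
  simp only at ht
  subst ht
  refine ⟨U, hU1, hU2, ?_⟩
  simp only [hG1] at hU3
  exact hU3

lemma diag_quad_re {I κ : Type} [Fintype I] [Fintype κ] [DecidableEq I] (e : I → ℝ) (Y : Matrix I κ ℂ) :
    (trace (Yᴴ * diagonal (fun i => (e i : ℂ)) * Y)).re = ∑ v, ∑ k, e k * ‖Y k v‖ ^ 2 := by
  simp only [trace, diag_apply, Matrix.mul_apply (N := Y), Matrix.mul_diagonal, conjTranspose_apply, Complex.re_sum]
  refine Finset.sum_congr rfl fun v _ => Finset.sum_congr rfl fun k _ => ?_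
  rw [← Complex.normSq_eq_norm_sq, Complex.normSq_apply]
  simp
  ring

lemma col_norm {I κ : Type} [Fintype I] [Fintype κ] [DecidableEq κ] (Y : Matrix I κ ℂ) (h : Yᴴ * Y = 1) (v : κ) :
    ∑ k, ‖Y k v‖ ^ 2 = 1 := by
  have h1 := congrArg Complex.re (congrFun (congrFun h v) v)
  simp only [Matrix.mul_apply, conjTranspose_apply, Matrix.one_apply_eq, Complex.one_re, Complex.re_sum] at h1
  rw [← h1]
  refine Finset.sum_congr rfl fun k _ => ?_
  rw [← Complex.normSq_eq_norm_sq, Complex.normSq_apply]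
  simp

open Classical in
theorem theoremT {κ lam : Type} [Fintype κ] [Fintype lam] [DecidableEq κ] [DecidableEq lam]
    (α : Fin 3 → κ → ℝ) (β : Fin 3 → lam → ℝ)
    (P : Fin 3 → Matrix κ κ ℝ) (R : Fin 3 → Matrix lam lam ℝ)
    (hP : ∀ s, (P s)ᵀ * P s = 1) (hR : ∀ s, (R s)ᵀ * R s = 1) (μ : ℝ)
    (h1 : ∑ s, P s * diagonal (α s) * (P s)ᵀ = μ • (1 : Matrix κ κ ℝ))
    (h2 : (μ • (1 : Matrix lam lam ℝ) - ∑ s, R s * diagonal (β s) * (R s)ᵀ).PosDef)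
    (hc : Fintype.card {x : Fin 3 × lam × κ // β x.1 x.2.1 < α x.1 x.2.2} ≤ Fintype.card lam * Fintype.card κ)
    (G : Fin 3 → Matrix (κ ⊕ lam) (κ ⊕ lam) ℂ) (hG : ∀ s, (G s)ᴴ * G s = 1) :
    ∃ U : Matrix (κ ⊕ lam) κ ℂ, Uᴴ * U = 1 ∧
      μ * Fintype.card κ ≤ (trace (Uᴴ * (∑ s, G s * diagonal (fun k => ((Sum.elim (α s) (β s) k : ℝ) : ℂ)) * (G s)ᴴ) * U)).re := by
  have hdet : ∀ s, (G s).det ≠ 0 := by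
    intro s h
    have := congrArg det (hG s)
    rw [det_mul, h] at this
    simp at this
  obtain ⟨U, hU1, hU2, hU3⟩ := frames_at_one α β P R hP hR μ h1 h2 hc G hdet
  have hG' : ∀ s, G s * (G s)ᴴ = 1 := fun s => mul_eq_one_comm.mp (hG s)
  refine ⟨U 0, hU1 0, ?_⟩
  have hadj : ∀ s, (G s).adjugate = (G s).det • (G s)ᴴ := by
    intro s
    calc (G s).adjugate = (G s).adjugate * (G s * (G s)ᴴ) := by rw [hG', Matrix.mul_one]
      _ = _ := by rw [← Matrix.mul_assoc, adjugate_mul, Matrix.smul_mul, Matrix.one_mul]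
  have hz : ∀ s k v, Sum.elim (α s) (β s) k < α s v → ((G s)ᴴ * U s) k v = 0 := by
    intro s k v h
    have := hU3 s k v h
    rw [hadj, Matrix.smul_mul, Matrix.smul_apply, smul_eq_mul] at this
    exact (mul_eq_zero.mp this).resolve_left (hdet s)
  have hYY : ∀ s, ((G s)ᴴ * U s)ᴴ * ((G s)ᴴ * U s) = 1 := by
    intro s
    rw [conjTranspose_mul, conjTranspose_conjTranspose, Matrix.mul_assoc, ← Matrix.mul_assoc (G s), hG', Matrix.one_mul, hU1]
  have hmu : μ * Fintype.card κ = ∑ s, ∑ v, α s v := by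
    have := congrArg trace h1
    rw [trace_sum, trace_smul, trace_one, smul_eq_mul] at this
    rw [← this]
    refine Finset.sum_congr rfl fun s _ => ?_
    rw [trace_mul_comm, ← Matrix.mul_assoc, hP, Matrix.one_mul, trace_diagonal]
  have e1 : trace ((U 0)ᴴ * (∑ s, G s * diagonal (fun k => ((Sum.elim (α s) (β s) k : ℝ) : ℂ)) * (G s)ᴴ) * U 0)
     = ∑ s, trace (((G s)ᴴ * U s)ᴴ * diagonal (fun k => ((Sum.elim (α s) (β s) k : ℝ) : ℂ)) * ((G s)ᴴ * U s)) := by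
    rw [Matrix.mul_sum, Matrix.sum_mul, trace_sum]
    refine Finset.sum_congr rfl fun s _ => ?_
    rw [Matrix.mul_assoc, trace_mul_comm, Matrix.mul_assoc, ← hU2 s, ← Matrix.mul_assoc, trace_mul_comm]
    congr 1
    rw [conjTranspose_mul, conjTranspose_conjTranspose]
    simp only [Matrix.mul_assoc]
  rw [e1, hmu, Complex.re_sum]
  refine Finset.sum_le_sum fun s _ => ?_
  rw [diag_quad_re]
  refine Finset.sum_le_sum fun v _ => ?_
  calc α s v = ∑ k, α s v * ‖((G s)ᴴ * U s) k v‖ ^ 2 := by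
        rw [← Finset.mul_sum, col_norm _ (hYY s), mul_one]
    _ ≤ _ := by
      refine Finset.sum_le_sum fun k _ => ?_
      by_cases h : Sum.elim (α s) (β s) k < α s v
      · rw [hz s k v h]; simp
      · exact mul_le_mul_of_nonneg_right (not_lt.mp h) (sq_nonneg _)

end

section
open Matrix Topology Filter

lemma first_order_scalar (c : ℝ) (r : ℝ → ℝ) (hr : Continuous r) (h : ∀ t, 0 ≤ t * c + t ^ 2 * r t) : c = 0 := by
  have hc : Continuous fun t => c + t * r t := by fun_prop
  by_contra hne
  rcases lt_or_gt_of_ne hne with hlt | hgt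
  · have : ∀ᶠ t in 𝓝[>] (0 : ℝ), c + t * r t < 0 :=
      nhdsWithin_le_nhds (hc.continuousAt.eventually_lt_const (by simpa using hlt))
    obtain ⟨t, ht, hpos⟩ := (this.and self_mem_nhdsWithin).exists
    have := h t
    have hp : 0 < t := hpos
    nlinarith
  · have : ∀ᶠ t in 𝓝[<] (0 : ℝ), 0 < c + t * r t :=
      nhdsWithin_le_nhds (hc.continuousAt.eventually_const_lt (by simpa using hgt))
    obtain ⟨t, ht, hneg⟩ := (this.and self_mem_nhdsWithin).exists
    have := h t
    have hp : t < 0 := hneg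
    nlinarith

lemma second_order_scalar (r : ℝ → ℝ) (hr : Continuous r) (h : ∀ t, 0 ≤ t ^ 2 * r t) : 0 ≤ r 0 := by
  by_contra hlt
  have : ∀ᶠ t in 𝓝[>] (0 : ℝ), r t < 0 :=
    nhdsWithin_le_nhds (hr.continuousAt.eventually_lt_const (not_le.mp hlt))
  obtain ⟨t, ht, hpos⟩ := (this.and self_mem_nhdsWithin).exists
  have := h t
  have hp : 0 < t := hpos
  nlinarith [mul_pos hp hp]

section
variable {n : Type} [Fintype n] [DecidableEq n]

lemma skew_det_ne (X : Matrix n n ℝ) (hX : Xᵀ = -X) (t : ℝ) : (1 - t • X).det ≠ 0 := by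
  intro hdet
  obtain ⟨v, hv, h⟩ := Matrix.exists_mulVec_eq_zero_iff.mpr hdet
  rw [Matrix.sub_mulVec, Matrix.one_mulVec, Matrix.smul_mulVec, sub_eq_zero] at h
  have h1 : v ⬝ᵥ (X *ᵥ v) = 0 := by
    have e : v ⬝ᵥ (X *ᵥ v) = - (v ⬝ᵥ (X *ᵥ v)) := by
      conv_lhs => rw [Matrix.dotProduct_mulVec, ← Matrix.mulVec_transpose, hX, Matrix.neg_mulVec, neg_dotProduct, dotProduct_comm]
    linarith
  have h2 : v ⬝ᵥ v = 0 := by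
    nth_rw 2 [h]
    rw [dotProduct_smul, h1, smul_zero]
  exact hv (dotProduct_self_eq_zero.mp h2)

/-- Cayley transform data -/
noncomputable def cay (X : Matrix n n ℝ) (t : ℝ) : Matrix n n ℝ := ((1 - t • X).det)⁻¹ • (1 - t • X).adjugate

lemma cay_mul (X : Matrix n n ℝ) (hX : Xᵀ = -X) (t : ℝ) : cay X t * (1 - t • X) = 1 := by
  rw [cay, Matrix.smul_mul, adjugate_mul, smul_smul, inv_mul_cancel₀ (skew_det_ne X hX t), one_smul]

lemma mul_cay (X : Matrix n n ℝ) (hX : Xᵀ = -X) (t : ℝ) : (1 - t • X) * cay X t = 1 :=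
  mul_eq_one_comm.mp (cay_mul X hX t)

lemma cay_cont (X : Matrix n n ℝ) (hX : Xᵀ = -X) : Continuous (cay X) := by
  unfold cay
  have h1 : Continuous fun t : ℝ => 1 - t • X := by fun_prop
  exact (h1.matrix_det.inv₀ (skew_det_ne X hX)).smul h1.matrix_adjugate

lemma cay_zero (X : Matrix n n ℝ) : cay X 0 = 1 := by simp [cay]

lemma cay_eq (X : Matrix n n ℝ) (hX : Xᵀ = -X) (t : ℝ) : cay X t = 1 + t • (X * cay X t) := by
  have := mul_cay X hX t
  rw [Matrix.sub_mul, Matrix.one_mul, Matrix.smul_mul] at this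
  rw [← this]; abel

noncomputable def cayV (X : Matrix n n ℝ) (t : ℝ) : Matrix n n ℝ := (1 + t • X) * cay X t

lemma cayV_orth (X : Matrix n n ℝ) (hX : Xᵀ = -X) (t : ℝ) : (cayV X t)ᵀ * cayV X t = 1 := by
  have h1 := congrArg transpose (mul_cay X hX t)
  simp only [transpose_mul, transpose_sub, transpose_one, transpose_smul, hX, smul_neg, sub_neg_eq_add] at h1
  have h2 := mul_cay X hX t
  unfold cayV
  rw [transpose_mul, transpose_add, transpose_one, transpose_smul, hX]
  have hcomm : (1 + t • -X) * (1 + t • X) = (1 + t • X) * (1 - t • X) := by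
    simp only [smul_neg, Matrix.add_mul, Matrix.mul_add, Matrix.mul_sub, Matrix.one_mul, Matrix.mul_one, Matrix.neg_mul,
      Matrix.smul_mul, Matrix.mul_smul, smul_add, smul_sub, smul_neg]
    abel
  calc (cay X t)ᵀ * (1 + t • -X) * ((1 + t • X) * cay X t)
      = (cay X t)ᵀ * ((1 + t • -X) * (1 + t • X)) * cay X t := by simp only [Matrix.mul_assoc]
    _ = ((cay X t)ᵀ * (1 + t • X)) * ((1 - t • X) * cay X t) := by rw [hcomm]; simp only [Matrix.mul_assoc]
    _ = 1 := by rw [h1, h2, Matrix.one_mul]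

/-- second coefficient -/
noncomputable def cayS (X a : Matrix n n ℝ) (t : ℝ) : Matrix n n ℝ :=
  (2 : ℝ) • (X * X * cay X t * a) + a * ((2 : ℝ) • (X * X * cay X t))ᵀ
    + ((2 : ℝ) • (X * cay X t)) * a * ((2 : ℝ) • (X * cay X t))ᵀ

lemma cayS_cont (X a : Matrix n n ℝ) (hX : Xᵀ = -X) : Continuous (cayS X a) := by
  unfold cayS
  have := cay_cont X hX
  fun_prop

lemma cayS_zero (X a : Matrix n n ℝ) (hX : Xᵀ = -X) :
    cayS X a 0 = (2 : ℝ) • (X * X * a + a * (X * X) - (2 : ℝ) • (X * a * X)) := by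
  unfold cayS
  rw [cay_zero]
  simp only [Matrix.mul_one, transpose_smul, transpose_mul, hX, Matrix.mul_smul, Matrix.smul_mul, Matrix.mul_neg, Matrix.neg_mul, neg_neg]
  simp only [smul_smul, smul_sub, smul_add, smul_neg, Matrix.mul_assoc]
  abel

lemma cayV_conj (X a : Matrix n n ℝ) (hX : Xᵀ = -X) (t : ℝ) :
    cayV X t * a * (cayV X t)ᵀ = a + t • ((2 : ℝ) • (X * a - a * X)) + t ^ 2 • cayS X a t := by
  have hV : cayV X t = 1 + t • ((2 : ℝ) • (X * cay X t)) := by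
    unfold cayV
    have h := mul_cay X hX t
    have : (1 + t • X) * cay X t = (1 - t • X) * cay X t + t • ((2 : ℝ) • (X * cay X t)) := by
      rw [Matrix.add_mul, Matrix.sub_mul, Matrix.smul_mul, two_smul, smul_add]
      abel
    rw [this, h]
  have hW : (2 : ℝ) • (X * cay X t) = (2 : ℝ) • X + t • ((2 : ℝ) • (X * X * cay X t)) := by
    conv_lhs => rw [cay_eq X hX t]
    rw [Matrix.mul_add, Matrix.mul_one, Matrix.mul_smul, smul_add, smul_comm t, Matrix.mul_assoc]
  rw [hV]
  have e1 : (1 + t • ((2 : ℝ) • (X * cay X t))) * a * (1 + t • ((2 : ℝ) • (X * cay X t)))ᵀ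
      = a + t • (((2 : ℝ) • (X * cay X t)) * a + a * ((2 : ℝ) • (X * cay X t))ᵀ)
        + t ^ 2 • (((2 : ℝ) • (X * cay X t)) * a * ((2 : ℝ) • (X * cay X t))ᵀ) := by
    generalize (2 : ℝ) • (X * cay X t) = W
    simp only [transpose_add, transpose_one, transpose_smul, Matrix.add_mul, Matrix.mul_add, Matrix.one_mul,
      Matrix.mul_one, Matrix.smul_mul, Matrix.mul_smul, smul_add, smul_smul, pow_two]
    abel
  rw [e1]
  unfold cayS
  have e2 : ((2 : ℝ) • (X * cay X t)) * a + a * ((2 : ℝ) • (X * cay X t))ᵀ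
     = (2 : ℝ) • (X * a - a * X) + t • ((2 : ℝ) • (X * X * cay X t * a) + a * ((2 : ℝ) • (X * X * cay X t))ᵀ) := by
    rw [hW]
    simp only [transpose_add, transpose_smul, hX, Matrix.add_mul, Matrix.mul_add, Matrix.smul_mul, Matrix.mul_smul, smul_add, smul_sub, smul_neg, Matrix.mul_neg]
    abel
  rw [e2, smul_add, smul_add (t ^ 2), smul_smul t t, ← pow_two]
  abel

theorem var_lemma (a : Fin 3 → Matrix n n ℝ) (m : Matrix n n ℝ) (hm : m = ∑ s, a s)
    (ha : ∀ s, (a s)ᵀ = a s)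
    (hmin : ∀ V : Fin 3 → Matrix n n ℝ, (∀ s, (V s)ᵀ * V s = 1) →
      trace (m * mᵀ) ≤ trace ((∑ s, V s * a s * (V s)ᵀ) * (∑ s, V s * a s * (V s)ᵀ)ᵀ))
    (X : Fin 3 → Matrix n n ℝ) (hX : ∀ s, (X s)ᵀ = - X s) :
    trace (m * ∑ s, (X s * a s - a s * X s)) = 0 ∧
    (∑ s, (X s * a s - a s * X s) = 0 →
      0 ≤ trace (m * ∑ s, (X s * X s * a s + a s * (X s * X s) - (2 : ℝ) • (X s * a s * X s)))) := by
  have hmT : mᵀ = m := by rw [hm, transpose_sum]; simp only [ha]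
  let L : Matrix n n ℝ := (2 : ℝ) • ∑ s, (X s * a s - a s * X s)
  let S : ℝ → Matrix n n ℝ := fun t => ∑ s, cayS (X s) (a s) t
  have hScont : Continuous S := continuous_finsetSum _ fun s _ => cayS_cont (X s) (a s) (hX s)
  have hsum : ∀ t, ∑ s, cayV (X s) t * a s * (cayV (X s) t)ᵀ = m + t • L + t ^ 2 • S t := by
    intro t
    simp only [cayV_conj _ _ (hX _), Finset.sum_add_distrib, hm, L, S, Finset.smul_sum]
  have hexp : ∀ t, 0 ≤ trace ((m + t • L + t ^ 2 • S t) * (m + t • L + t ^ 2 • S t)ᵀ) - trace (m * mᵀ) := by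
    intro t
    have := hmin (fun s => cayV (X s) t) (fun s => cayV_orth (X s) (hX s) t)
    rw [hsum] at this
    linarith
  have htr : ∀ A : Matrix n n ℝ, trace (A * m) = trace (m * A) := fun A => trace_mul_comm _ _
  have htr2 : ∀ A : Matrix n n ℝ, trace (m * Aᵀ) = trace (m * A) := by
    intro A
    rw [← trace_transpose, transpose_mul, transpose_transpose, hmT, trace_mul_comm]
  have hL : trace (m * L) = 2 * trace (m * ∑ s, (X s * a s - a s * X s)) := by
    simp [L]
  have hexp2 : ∀ t, 0 ≤ t * (2 * trace (m * L)) + t ^ 2 * (2 * trace (m * S t) + trace (L * Lᵀ)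
      + t * trace (L * (S t)ᵀ) + t * trace (S t * Lᵀ) + t ^ 2 * trace (S t * (S t)ᵀ)) := by
    intro t
    refine (hexp t).trans (le_of_eq ?_)
    simp only [transpose_add, transpose_smul, Matrix.add_mul, Matrix.mul_add, trace_add, Matrix.smul_mul, Matrix.mul_smul, trace_smul, smul_eq_mul, hmT, htr, htr2]
    ring
  constructor
  · have := first_order_scalar (2 * trace (m * L)) _ (by fun_prop) hexp2
    linarith
  · intro h0
    have hL0 : L = 0 := by simp only [L, h0, smul_zero]
    rw [hL0] at hexp2
    have h3 := second_order_scalar (fun t => 2 * trace (m * S t) + t ^ 2 * trace (S t * (S t)ᵀ)) (by fun_prop)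
      (by intro t; have := hexp2 t; simpa using this)
    have hS0 : S 0 = (2 : ℝ) • ∑ s, (X s * X s * a s + a s * (X s * X s) - (2 : ℝ) • (X s * a s * X s)) := by
      simp only [S, cayS_zero _ _ (hX _), Finset.smul_sum]
    simp only [hS0] at h3
    rw [Matrix.mul_smul, trace_smul] at h3
    simp only [smul_eq_mul] at h3
    linarith

/-- first order condition -/
theorem comm_of_min (a : Fin 3 → Matrix n n ℝ) (m : Matrix n n ℝ) (hm : m = ∑ s, a s)
    (ha : ∀ s, (a s)ᵀ = a s)
    (hmin : ∀ V : Fin 3 → Matrix n n ℝ, (∀ s, (V s)ᵀ * V s = 1) →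
      trace (m * mᵀ) ≤ trace ((∑ s, V s * a s * (V s)ᵀ) * (∑ s, V s * a s * (V s)ᵀ)ᵀ)) (s : Fin 3) :
    a s * m = m * a s := by
  have hmT : mᵀ = m := by rw [hm, transpose_sum]; simp only [ha]
  set Y := a s * m - m * a s with hY
  have hYT : Yᵀ = -Y := by
    rw [hY, transpose_sub, transpose_mul, transpose_mul, hmT, ha]; abel
  have h := (var_lemma a m hm ha hmin (fun s' => if s' = s then Y else 0)
    (by intro s'; split_ifs <;> simp [hYT])).1
  have e : ∑ s', ((if s' = s then Y else 0) * a s' - a s' * (if s' = s then Y else 0)) = Y * a s - a s * Y := by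
    rw [Finset.sum_eq_single s]
    · simp
    · intro b _ hb; simp [hb]
    · simp
  simp only [e] at h
  have h2 : trace (Y * Yᵀ) = 0 := by
    have : trace (m * (Y * a s - a s * Y)) = trace (Y * Y) := by
      have e0 : trace (Y * Y) = trace (a s * m * Y) - trace (m * a s * Y) := by
        rw [← trace_sub, ← Matrix.sub_mul]
      rw [Matrix.mul_sub, trace_sub, e0]
      have e1 : trace (m * (Y * a s)) = trace (a s * m * Y) := by
        rw [← Matrix.mul_assoc, trace_mul_comm, Matrix.mul_assoc]
      rw [e1, Matrix.mul_assoc m]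
    rw [hYT, Matrix.mul_neg, trace_neg, ← this, h, neg_zero]
  have h3 : Y = 0 := by
    have := (Matrix.trace_mul_conjTranspose_self_eq_zero_iff (A := Y)).mp (by simpa [conjTranspose_eq_transpose_of_trivial] using h2)
    exact this
  exact sub_eq_zero.mp h3

end

end

section
open Matrix Topology Filter

lemma symm_diag {n : Type} [Fintype n] [DecidableEq n] (A : Matrix n n ℝ) (hA : Aᵀ = A) :
    ∃ (Q : Matrix n n ℝ) (d : n → ℝ), Qᵀ * Q = 1 ∧ A = Q * diagonal d * Qᵀ := by
  have hH : A.IsHermitian := by rw [Matrix.IsHermitian, conjTranspose_eq_transpose_of_trivial, hA]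
  refine ⟨hH.eigenvectorUnitary, hH.eigenvalues, ?_, ?_⟩
  · have := (Matrix.mem_unitaryGroup_iff'.mp hH.eigenvectorUnitary.2)
    simpa [star_eq_conjTranspose, conjTranspose_eq_transpose_of_trivial] using this
  · have := hH.spectral_theorem
    rw [Unitary.conjStarAlgAut_apply] at this
    rw [star_eq_conjTranspose, conjTranspose_eq_transpose_of_trivial] at this
    exact this

section
variable {κ lam : Type} [Fintype κ] [Fintype lam] [DecidableEq κ] [DecidableEq lam]

lemma fromBlocks_sub_aux (A A' : Matrix κ κ ℝ) (B B' : Matrix κ lam ℝ) (C C' : Matrix lam κ ℝ) (D D' : Matrix lam lam ℝ) :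
    fromBlocks A B C D - fromBlocks A' B' C' D' = fromBlocks (A - A') (B - B') (C - C') (D - D') := by
  ext i j
  rcases i with i | i <;> rcases j with j | j <;> simp

lemma trace_fromBlocks_aux (A : Matrix κ κ ℝ) (B : Matrix κ lam ℝ) (C : Matrix lam κ ℝ) (D : Matrix lam lam ℝ) :
    trace (fromBlocks A B C D) = trace A + trace D := by
  simp [trace, Fintype.sum_sum_type]

/-- the trace identity -/
lemma second_id (μ : ℝ) (θ k : lam → ℝ) (hk : ∀ q, k q * k q = μ - θ q) (a1 : Matrix κ κ ℝ) (a2 : Matrix lam lam ℝ)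
    (hc : a2 * diagonal θ = diagonal θ * a2) (hck : a2 * diagonal k = diagonal k * a2)
    (φ : Matrix lam κ ℝ) :
    trace (diagonal (Sum.elim (fun _ : κ => μ) θ) *
      ((fromBlocks 0 (-φᵀ) φ 0 * fromBlocks 0 (-φᵀ) φ 0) * fromBlocks a1 0 0 a2
        + fromBlocks a1 0 0 a2 * (fromBlocks 0 (-φᵀ) φ 0 * fromBlocks 0 (-φᵀ) φ 0)
        - (2 : ℝ) • (fromBlocks 0 (-φᵀ) φ 0 * fromBlocks a1 0 0 a2 * fromBlocks 0 (-φᵀ) φ 0)))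
    = - 2 * trace ((diagonal k * φ * a1 - a2 * (diagonal k * φ)) * (diagonal k * φ)ᵀ) := by
  have hd : diagonal (Sum.elim (fun _ : κ => μ) θ) = fromBlocks (μ • (1 : Matrix κ κ ℝ)) 0 0 (diagonal θ) := by
    rw [← fromBlocks_diagonal]
    congr 1
    rw [← diagonal_one, ← diagonal_smul]
    congr 1
    funext i; simp
  have hkk : diagonal k * diagonal k = μ • (1 : Matrix lam lam ℝ) - diagonal θ := by
    rw [diagonal_mul_diagonal, ← diagonal_one, ← diagonal_smul, diagonal_sub]
    congr 1
    funext i; simp [hk]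
  have hR : trace ((diagonal k * φ * a1 - a2 * (diagonal k * φ)) * (diagonal k * φ)ᵀ)
      = trace ((μ • (1 : Matrix lam lam ℝ) - diagonal θ) * ((φ * a1 - a2 * φ) * φᵀ)) := by
    rw [← hkk]
    have : (diagonal k * φ * a1 - a2 * (diagonal k * φ)) * (diagonal k * φ)ᵀ
       = diagonal k * ((φ * a1 - a2 * φ) * φᵀ) * diagonal k := by
      rw [← Matrix.mul_assoc a2, hck, transpose_mul, diagonal_transpose]
      simp only [Matrix.mul_sub, Matrix.sub_mul, Matrix.mul_assoc]
    rw [this, trace_mul_comm, Matrix.mul_assoc]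
  rw [hR, hd]
  simp only [fromBlocks_multiply, fromBlocks_add, fromBlocks_smul, fromBlocks_sub_aux, Matrix.zero_mul, Matrix.mul_zero, zero_add, add_zero, trace_fromBlocks_aux]
  have t1 : trace (φᵀ * φ * a1) = trace (φ * a1 * φᵀ) := by
    rw [Matrix.mul_assoc, trace_mul_comm]
  have t2 : trace (a1 * (φᵀ * φ)) = trace (φ * a1 * φᵀ) := by
    rw [trace_mul_comm, t1]
  have t3 : trace (φᵀ * a2 * φ) = trace (a2 * φ * φᵀ) := by
    rw [Matrix.mul_assoc, trace_mul_comm]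
  have t4 : trace (diagonal θ * (φ * φᵀ * a2)) = trace (diagonal θ * (a2 * φ * φᵀ)) := by
    rw [← Matrix.mul_assoc, trace_mul_comm, ← Matrix.mul_assoc, hc]
    simp only [Matrix.mul_assoc]
  simp only [Matrix.mul_sub, Matrix.sub_mul, Matrix.mul_add, Matrix.neg_mul, Matrix.mul_neg, Matrix.smul_mul, Matrix.mul_smul,
    Matrix.one_mul, trace_add, trace_sub, trace_neg, trace_smul, smul_neg, t1, t2, t3, t4, smul_eq_mul]
  have t5 : trace (diagonal θ * (a2 * (φ * φᵀ))) = trace (diagonal θ * (a2 * φ * φᵀ)) := by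
    simp only [Matrix.mul_assoc]
  rw [t5]
  ring

open Classical in
theorem theoremS_core (a : Fin 3 → Matrix (κ ⊕ lam) (κ ⊕ lam) ℝ) (μ : ℝ) (θ : lam → ℝ) (hθ : ∀ q, θ q < μ)
    (ha : ∀ s, (a s)ᵀ = a s)
    (hm : ∑ s, a s = diagonal (Sum.elim (fun _ : κ => μ) θ))
    (hmin : ∀ V : Fin 3 → Matrix (κ ⊕ lam) (κ ⊕ lam) ℝ, (∀ s, (V s)ᵀ * V s = 1) →
      trace ((∑ s, a s) * (∑ s, a s)ᵀ) ≤ trace ((∑ s, V s * a s * (V s)ᵀ) * (∑ s, V s * a s * (V s)ᵀ)ᵀ)) :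
    ∃ (α : Fin 3 → κ → ℝ) (β : Fin 3 → lam → ℝ) (P : Fin 3 → Matrix κ κ ℝ) (R : Fin 3 → Matrix lam lam ℝ),
      (∀ s, (P s)ᵀ * P s = 1) ∧ (∀ s, (R s)ᵀ * R s = 1) ∧
      (∀ s, a s = fromBlocks (P s * diagonal (α s) * (P s)ᵀ) 0 0 (R s * diagonal (β s) * (R s)ᵀ)) ∧
      Fintype.card {x : Fin 3 × lam × κ // β x.1 x.2.1 < α x.1 x.2.2} ≤ Fintype.card lam * Fintype.card κ := by
  have hcomm := comm_of_min a (∑ s, a s) rfl ha hmin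
  have hent : ∀ s i j, a s i j * (Sum.elim (fun _ : κ => μ) θ j - Sum.elim (fun _ : κ => μ) θ i) = 0 := by
    intro s i j
    have h := congrFun (congrFun (hcomm s) i) j
    rw [hm, Matrix.mul_diagonal, Matrix.diagonal_mul] at h
    linarith
  have hb12 : ∀ s, (a s).toBlocks₁₂ = 0 := by
    intro s; ext v q
    have := hent s (Sum.inl v) (Sum.inr q)
    simp only [Sum.elim_inl, Sum.elim_inr] at this
    exact (mul_eq_zero.mp this).resolve_right (by linarith [hθ q])
  have hb21 : ∀ s, (a s).toBlocks₂₁ = 0 := by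
    intro s; ext q v
    have := hent s (Sum.inr q) (Sum.inl v)
    simp only [Sum.elim_inl, Sum.elim_inr] at this
    exact (mul_eq_zero.mp this).resolve_right (by linarith [hθ q])
  have hab : ∀ s, a s = fromBlocks (a s).toBlocks₁₁ 0 0 (a s).toBlocks₂₂ := by
    intro s
    conv_lhs => rw [← fromBlocks_toBlocks (a s), hb12, hb21]
  have hs1 : ∀ s, ((a s).toBlocks₁₁)ᵀ = (a s).toBlocks₁₁ := by
    intro s; ext i j; exact congrFun (congrFun (ha s) (Sum.inl i)) (Sum.inl j)
  have hs2 : ∀ s, ((a s).toBlocks₂₂)ᵀ = (a s).toBlocks₂₂ := by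
    intro s; ext i j; exact congrFun (congrFun (ha s) (Sum.inr i)) (Sum.inr j)
  choose P α hP hPa using fun s => symm_diag _ (hs1 s)
  choose R β hR hRa using fun s => symm_diag _ (hs2 s)
  refine ⟨α, β, P, R, hP, hR, ?_, ?_⟩
  · intro s; rw [← hPa, ← hRa]; exact hab s
  have hkθ : ∀ (f : ℝ → ℝ) s, (a s).toBlocks₂₂ * diagonal (fun q => f (θ q)) = diagonal (fun q => f (θ q)) * (a s).toBlocks₂₂ := by
    intro f s
    ext q q'
    rw [Matrix.mul_diagonal, Matrix.diagonal_mul]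
    have := hent s (Sum.inr q) (Sum.inr q')
    simp only [Sum.elim_inr] at this
    rcases mul_eq_zero.mp this with h | h
    · have h' : (a s).toBlocks₂₂ q q' = 0 := h
      rw [h']; ring
    · rw [show θ q' = θ q by linarith, mul_comm]
  let ψ' : ({x : Fin 3 × lam × κ // β x.1 x.2.1 < α x.1 x.2.2} → ℝ) → Fin 3 → Matrix lam κ ℝ := fun y s =>
    Matrix.of fun q v => if h : β s q < α s v then y ⟨(s, q, v), h⟩ else 0
  let Lmap : ({x : Fin 3 × lam × κ // β x.1 x.2.1 < α x.1 x.2.2} → ℝ) →ₗ[ℝ] Matrix lam κ ℝ :=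
    { toFun := fun y => ∑ s, R s * (ψ' y s * diagonal (α s) - diagonal (β s) * ψ' y s) * (P s)ᵀ
      map_add' := by
        intro x y
        have e1 : ∀ s, ψ' (x + y) s = ψ' x s + ψ' y s := by
          intro s; ext q v; simp only [ψ', Matrix.add_apply, of_apply]; split_ifs <;> simp
        rw [← Finset.sum_add_distrib]
        refine Finset.sum_congr rfl fun s _ => ?_
        rw [e1, ← Matrix.add_mul, ← Matrix.mul_add]
        congr 2
        rw [Matrix.add_mul, Matrix.mul_add]; abel
      map_smul' := by
        intro c x
        have e1 : ∀ s, ψ' (c • x) s = c • ψ' x s := by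
          intro s; ext q v; simp only [ψ', Matrix.smul_apply, of_apply]; split_ifs <;> simp
        simp only [e1, RingHom.id_apply, Finset.smul_sum]
        refine Finset.sum_congr rfl fun s _ => ?_
        rw [Matrix.smul_mul, Matrix.mul_smul, ← smul_sub, Matrix.mul_smul, Matrix.smul_mul] }
  have hinj : Function.Injective Lmap := by
    rw [injective_iff_map_eq_zero]
    intro y hy
    have hy' : ∑ s, R s * (ψ' y s * diagonal (α s) - diagonal (β s) * ψ' y s) * (P s)ᵀ = 0 := hy
    let k : lam → ℝ := fun q => Real.sqrt (μ - θ q)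
    let ki : lam → ℝ := fun q => (Real.sqrt (μ - θ q))⁻¹
    have hk0 : ∀ q, k q ≠ 0 := fun q => (Real.sqrt_pos.mpr (by linarith [hθ q])).ne'
    have hkk : ∀ q, k q * k q = μ - θ q := fun q => Real.mul_self_sqrt (by linarith [hθ q])
    have hkki : diagonal k * diagonal ki = 1 := by
      rw [diagonal_mul_diagonal, ← diagonal_one]
      congr 1; funext q; exact mul_inv_cancel₀ (hk0 q)
    let ψ : Fin 3 → Matrix lam κ ℝ := fun s => R s * ψ' y s * (P s)ᵀ
    have hψ : ∀ s, ψ s * (a s).toBlocks₁₁ - (a s).toBlocks₂₂ * ψ s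
        = R s * (ψ' y s * diagonal (α s) - diagonal (β s) * ψ' y s) * (P s)ᵀ := by
      intro s
      rw [hPa, hRa]
      simp only [ψ, Matrix.mul_sub, Matrix.sub_mul]
      congr 1
      · calc R s * ψ' y s * (P s)ᵀ * (P s * diagonal (α s) * (P s)ᵀ)
            = R s * ψ' y s * ((P s)ᵀ * P s) * (diagonal (α s) * (P s)ᵀ) := by simp only [Matrix.mul_assoc]
          _ = _ := by rw [hP]; simp only [Matrix.mul_assoc, Matrix.one_mul]
      · calc R s * diagonal (β s) * (R s)ᵀ * (R s * ψ' y s * (P s)ᵀ)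
            = R s * diagonal (β s) * ((R s)ᵀ * R s) * (ψ' y s * (P s)ᵀ) := by simp only [Matrix.mul_assoc]
          _ = _ := by rw [hR]; simp only [Matrix.mul_assoc, Matrix.one_mul]
    let φ : Fin 3 → Matrix lam κ ℝ := fun s => diagonal ki * ψ s
    have hKφ : ∀ s, diagonal k * φ s = ψ s := by
      intro s
      simp only [φ]
      rw [← Matrix.mul_assoc, hkki, Matrix.one_mul]
    let X : Fin 3 → Matrix (κ ⊕ lam) (κ ⊕ lam) ℝ := fun s => fromBlocks 0 (-(φ s)ᵀ) (φ s) 0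
    have hXT : ∀ s, (X s)ᵀ = - X s := by
      intro s
      simp only [X, fromBlocks_transpose, fromBlocks_neg, transpose_neg, transpose_transpose, neg_zero, transpose_zero, neg_neg]
    have hφz : ∑ s, (φ s * (a s).toBlocks₁₁ - (a s).toBlocks₂₂ * φ s) = 0 := by
      have : ∀ s, φ s * (a s).toBlocks₁₁ - (a s).toBlocks₂₂ * φ s =
          diagonal ki * (ψ s * (a s).toBlocks₁₁ - (a s).toBlocks₂₂ * ψ s) := by
        intro s
        simp only [φ]
        rw [← Matrix.mul_assoc ((a s).toBlocks₂₂), hkθ (fun x => (Real.sqrt (μ - x))⁻¹) s, Matrix.mul_sub]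
        simp only [Matrix.mul_assoc, ki]
      simp only [this, hψ]
      rw [← Matrix.mul_sum, hy', Matrix.mul_zero]
    have hbr : ∀ s, X s * a s - a s * X s = fromBlocks 0 ((φ s * (a s).toBlocks₁₁ - (a s).toBlocks₂₂ * φ s)ᵀ)
        (φ s * (a s).toBlocks₁₁ - (a s).toBlocks₂₂ * φ s) 0 := by
      intro s
      conv_lhs => rw [hab s]
      simp only [X, fromBlocks_multiply, fromBlocks_sub_aux, Matrix.zero_mul, Matrix.mul_zero, add_zero, zero_add, sub_zero,
        transpose_sub, transpose_mul, hs1, hs2, Matrix.neg_mul, Matrix.mul_neg]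
      congr 1
      · abel
      · simp
    have hsum0 : ∑ s, (X s * a s - a s * X s) = 0 := by
      simp only [hbr]
      have : ∀ Z : Fin 3 → Matrix lam κ ℝ, ∑ s, fromBlocks (0 : Matrix κ κ ℝ) (Z s)ᵀ (Z s) (0 : Matrix lam lam ℝ)
          = fromBlocks 0 (∑ s, Z s)ᵀ (∑ s, Z s) 0 := by
        intro Z
        simp [Fin.sum_univ_three, fromBlocks_add]
      rw [this, hφz]
      simp
    have h2nd := (var_lemma a (∑ s, a s) rfl ha hmin X hXT).2 hsum0
    have hid : ∀ s, trace (diagonal (Sum.elim (fun _ : κ => μ) θ) * (X s * X s * a s + a s * (X s * X s) - (2 : ℝ) • (X s * a s * X s)))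
        = -2 * trace ((ψ s * (a s).toBlocks₁₁ - (a s).toBlocks₂₂ * ψ s) * (ψ s)ᵀ) := by
      intro s
      have := second_id μ θ k hkk (a s).toBlocks₁₁ (a s).toBlocks₂₂ (hkθ id s) (hkθ (fun x => Real.sqrt (μ - x)) s) (φ s)
      rw [← hab s, hKφ] at this
      exact this
    rw [Matrix.mul_sum, trace_sum, hm] at h2nd
    simp only [hid] at h2nd
    have hval : ∀ s, trace ((ψ s * (a s).toBlocks₁₁ - (a s).toBlocks₂₂ * ψ s) * (ψ s)ᵀ)
        = ∑ q, ∑ v, (α s v - β s q) * (ψ' y s q v) ^ 2 := by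
      intro s
      rw [hψ]
      simp only [ψ]
      have : R s * (ψ' y s * diagonal (α s) - diagonal (β s) * ψ' y s) * (P s)ᵀ * (R s * ψ' y s * (P s)ᵀ)ᵀ
        = R s * ((ψ' y s * diagonal (α s) - diagonal (β s) * ψ' y s) * (((P s)ᵀ * P s) * ((ψ' y s)ᵀ * (R s)ᵀ))) := by
        simp only [transpose_mul, transpose_transpose, Matrix.mul_assoc]
      rw [this, hP, Matrix.one_mul, trace_mul_comm, ← Matrix.mul_assoc, Matrix.mul_assoc, Matrix.mul_assoc, hR, Matrix.mul_one]
      simp only [trace, diag_apply, Matrix.mul_apply (N := (ψ' y s)ᵀ), Matrix.sub_apply, Matrix.mul_diagonal, Matrix.diagonal_mul, transpose_apply]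
      refine Finset.sum_congr rfl fun q _ => Finset.sum_congr rfl fun v _ => ?_
      ring
    simp only [hval] at h2nd
    have hnn : ∀ s q v, 0 ≤ (α s v - β s q) * (ψ' y s q v) ^ 2 := by
      intro s q v
      by_cases h : β s q < α s v
      · exact mul_nonneg (by linarith) (sq_nonneg _)
      · simp [ψ', h]
    rw [← Finset.mul_sum] at h2nd
    have hz : ∑ s, ∑ q, ∑ v, (α s v - β s q) * (ψ' y s q v) ^ 2 = 0 := by
      refine le_antisymm (by linarith) ?_
      exact Finset.sum_nonneg fun s _ => Finset.sum_nonneg fun q _ => Finset.sum_nonneg fun v _ => hnn s q v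
    funext ⟨⟨s, q, v⟩, h⟩
    have z1 := (Finset.sum_eq_zero_iff_of_nonneg (fun s _ => Finset.sum_nonneg fun q _ => Finset.sum_nonneg fun v _ => hnn s q v)).mp hz s (Finset.mem_univ _)
    have z2 := (Finset.sum_eq_zero_iff_of_nonneg (fun q _ => Finset.sum_nonneg fun v _ => hnn s q v)).mp z1 q (Finset.mem_univ _)
    have z3 := (Finset.sum_eq_zero_iff_of_nonneg (fun v _ => hnn s q v)).mp z2 v (Finset.mem_univ _)
    simp only at h
    have z4 := (mul_eq_zero.mp z3).resolve_left (by linarith)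
    have z5 := pow_eq_zero_iff (two_ne_zero) |>.mp z4
    simp only [ψ', of_apply, dif_pos h] at z5
    exact z5
  have h5 := LinearMap.finrank_le_finrank_of_injective hinj
  rw [Module.finrank_pi, Module.finrank_matrix] at h5
  simpa using h5

end

end

section
open Matrix Topology Filter

lemma equiv_of_map_eq {A B : Type} [Fintype A] [Fintype B] (f : A → ℝ) (g : B → ℝ)
    (h : Multiset.map f Finset.univ.val = Multiset.map g Finset.univ.val) : ∃ e : A ≃ B, f = g ∘ e := by
  classical
  have hcard : ∀ y, Fintype.card {x // f x = y} = Fintype.card {x // g x = y} := by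
    intro y
    have h1 := congrArg (Multiset.count y) h
    rw [Multiset.count_map, Multiset.count_map] at h1
    rw [Fintype.card_subtype, Fintype.card_subtype, Finset.card_def, Finset.card_def, Finset.filter_val, Finset.filter_val]
    simpa only [eq_comm] using h1
  let E : ∀ y, {x // f x = y} ≃ {x // g x = y} := fun y => Fintype.equivOfCardEq (hcard y)
  refine ⟨((Equiv.sigmaFiberEquiv f).symm.trans (Equiv.sigmaCongrRight E)).trans (Equiv.sigmaFiberEquiv g), ?_⟩
  funext x
  have := (E (f x) ⟨x, rfl⟩).2
  simp only [Function.comp_apply, Equiv.trans_apply]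
  exact this.symm

open Polynomial in
lemma equiv_of_prod_eq {A B : Type} [Fintype A] [Fintype B] (f : A → ℝ) (g : B → ℝ)
    (h : ∏ i, (X - C (f i)) = ∏ i, (X - C (g i))) : ∃ e : A ≃ B, f = g ∘ e := by
  refine equiv_of_map_eq f g ?_
  have h1 := congrArg Polynomial.roots h
  rw [Polynomial.roots_prod _ _ (by simp [Finset.prod_ne_zero_iff, Polynomial.X_sub_C_ne_zero]),
    Polynomial.roots_prod _ _ (by simp [Finset.prod_ne_zero_iff, Polynomial.X_sub_C_ne_zero])] at h1
  simpa using h1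

lemma charpoly_conj_rect {A B : Type} [Fintype A] [Fintype B] [DecidableEq A] [DecidableEq B] (e : A ≃ B)
    (Q : Matrix B A ℝ) (hQ : Q * Qᵀ = 1) (M : Matrix B B ℝ) : (Qᵀ * M * Q).charpoly = M.charpoly := by
  rw [Matrix.mul_assoc, charpoly_mul_comm_of_le _ _ (Fintype.card_congr e).ge, Fintype.card_congr e, Matrix.mul_assoc, hQ]
  simp

lemma entry_le_real {I κ : Type} [Fintype I] [Fintype κ] [DecidableEq κ] (U : Matrix I κ ℝ) (h : Uᵀ * U = 1) (i : I) (j : κ) :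
    U i j ∈ Metric.closedBall (0 : ℝ) 1 := by
  have h1 := (congrFun (congrFun h j) j)
  simp only [Matrix.mul_apply, transpose_apply, Matrix.one_apply_eq] at h1
  have h3 := Finset.single_le_sum (f := fun k => U k j * U k j) (fun k _ => mul_self_nonneg _) (Finset.mem_univ i)
  simp only [h1] at h3
  rw [mem_closedBall_zero_iff, Real.norm_eq_abs]
  exact abs_le_one_iff_mul_self_le_one.mpr h3

lemma compact_orth {n : Type} [Fintype n] [DecidableEq n] :
    IsCompact {U : Fin 3 → Matrix n n ℝ | ∀ s, (U s)ᵀ * U s = 1} := by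
  have hK : IsCompact (Set.univ.pi fun _ : Fin 3 => Set.univ.pi fun _ : n => Set.univ.pi fun _ : n => Metric.closedBall (0 : ℝ) 1) :=
    isCompact_univ_pi fun _ => isCompact_univ_pi fun _ => isCompact_univ_pi fun _ => isCompact_closedBall _ _
  refine IsCompact.of_isClosed_subset hK ?_ ?_
  · have : {U : Fin 3 → Matrix n n ℝ | ∀ s, (U s)ᵀ * U s = 1} = ⋂ s, {U : Fin 3 → Matrix n n ℝ | (U s)ᵀ * U s = 1} := by
      ext; simp
    rw [this]
    refine isClosed_iInter fun s => isClosed_eq ?_ continuous_const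
    fun_prop
  · intro U hU s _ i _ j _
    exact entry_le_real (U s) (hU s) i j

open Classical in
theorem theoremS {n : Type} [Fintype n] [DecidableEq n] [Nonempty n] (d : Fin 3 → n → ℝ) :
    ∃ (κ lam : Type) (_ : Fintype κ) (_ : Fintype lam) (_ : DecidableEq κ) (_ : DecidableEq lam) (_ : Nonempty κ)
      (α : Fin 3 → κ → ℝ) (β : Fin 3 → lam → ℝ) (P : Fin 3 → Matrix κ κ ℝ) (R : Fin 3 → Matrix lam lam ℝ)
      (μ : ℝ) (θ : lam → ℝ) (e : Fin 3 → (κ ⊕ lam ≃ n)) (O : Fin 3 → Matrix n n ℝ),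
      (∀ s, (P s)ᵀ * P s = 1) ∧ (∀ s, (R s)ᵀ * R s = 1) ∧ (∀ s, (O s)ᵀ * O s = 1) ∧ (∀ q, θ q < μ) ∧
      (∑ s, P s * diagonal (α s) * (P s)ᵀ = μ • (1 : Matrix κ κ ℝ)) ∧
      (∑ s, R s * diagonal (β s) * (R s)ᵀ = diagonal θ) ∧
      Fintype.card {x : Fin 3 × lam × κ // β x.1 x.2.1 < α x.1 x.2.2} ≤ Fintype.card lam * Fintype.card κ ∧
      (∀ s, Sum.elim (α s) (β s) = d s ∘ e s) ∧
      trace ((∑ s, O s * diagonal (d s) * (O s)ᵀ) * (∑ s, O s * diagonal (d s) * (O s)ᵀ)ᵀ)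
        = Fintype.card κ * μ ^ 2 + ∑ q, θ q ^ 2 := by
  obtain ⟨O, hO, hOmin⟩ := (compact_orth (n := n)).exists_isMinOn ⟨fun _ => 1, by simp⟩
    (f := fun O : Fin 3 → Matrix n n ℝ => trace ((∑ s, O s * diagonal (d s) * (O s)ᵀ) * (∑ s, O s * diagonal (d s) * (O s)ᵀ)ᵀ))
    (by fun_prop)
  have hO : ∀ s, (O s)ᵀ * O s = 1 := hO
  have hO' : ∀ s, O s * (O s)ᵀ = 1 := fun s => mul_eq_one_comm.mp (hO s)
  set M := ∑ s, O s * diagonal (d s) * (O s)ᵀ with hM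
  have hMT : Mᵀ = M := by
    rw [hM, transpose_sum]
    simp [transpose_mul, Matrix.mul_assoc]
  obtain ⟨E, η, hE, hME⟩ := symm_diag M hMT
  have hE' : E * Eᵀ = 1 := mul_eq_one_comm.mp hE
  obtain ⟨i0, hi0⟩ := Finite.exists_max η
  let pr : n → Prop := fun i => η i = η i0
  let κ := {i // pr i}
  let lam := {i // ¬ pr i}
  let e0 : κ ⊕ lam ≃ n := Equiv.sumCompl pr
  let Pm : Matrix n (κ ⊕ lam) ℝ := (1 : Matrix n n ℝ).submatrix id e0
  have hPm1 : Pmᵀ * Pm = 1 := by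
    have : Pmᵀ = (1 : Matrix n n ℝ).submatrix e0 id := by simp [Pm, transpose_submatrix]
    rw [this]
    simp only [Pm]
    rw [Matrix.submatrix_mul _ _ e0 id e0 Function.bijective_id |>.symm]
    simp
  have hPmd : Pmᵀ * diagonal η * Pm = diagonal (η ∘ e0) := by
    have : Pmᵀ = (1 : Matrix n n ℝ).submatrix e0 id := by simp [Pm, transpose_submatrix]
    rw [this]
    have h2 : diagonal η = (diagonal η).submatrix id id := by simp
    simp only [Pm]
    rw [h2, (Matrix.submatrix_mul _ _ e0 id id Function.bijective_id).symm, (Matrix.submatrix_mul _ _ e0 id e0 Function.bijective_id).symm]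
    rw [Matrix.one_mul, Matrix.mul_one, Matrix.submatrix_diagonal_equiv]
  have hPm2 : Pm * Pmᵀ = 1 := by
    have : Pmᵀ = (1 : Matrix n n ℝ).submatrix e0 id := by simp [Pm, transpose_submatrix]
    rw [this]
    simp only [Pm]
    rw [(Matrix.submatrix_mul _ _ id e0 id e0.bijective).symm]
    simp
  set Q : Matrix n (κ ⊕ lam) ℝ := E * Pm with hQ
  have hQ1 : Qᵀ * Q = 1 := by
    rw [hQ, transpose_mul, Matrix.mul_assoc, ← Matrix.mul_assoc Eᵀ, hE, Matrix.one_mul, hPm1]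
  have hQ2 : Q * Qᵀ = 1 := by
    rw [hQ, transpose_mul, Matrix.mul_assoc, ← Matrix.mul_assoc Pm, hPm2, Matrix.one_mul, hE']
  let a : Fin 3 → Matrix (κ ⊕ lam) (κ ⊕ lam) ℝ := fun s => Qᵀ * (O s * diagonal (d s) * (O s)ᵀ) * Q
  let θ : lam → ℝ := fun q => η q
  have hsum : ∑ s, a s = Qᵀ * M * Q := by
    rw [hM, Matrix.mul_sum, Matrix.sum_mul]
  have hdiag : ∑ s, a s = diagonal (Sum.elim (fun _ : κ => η i0) θ) := by
    rw [hsum, hME, hQ]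
    calc (E * Pm)ᵀ * (E * diagonal η * Eᵀ) * (E * Pm) = Pmᵀ * ((Eᵀ * E) * diagonal η * (Eᵀ * E)) * Pm := by
          simp only [transpose_mul, Matrix.mul_assoc]
      _ = _ := by
        rw [hE, Matrix.one_mul, Matrix.mul_one, hPmd]
        congr 1
        funext k
        rcases k with k | k
        · exact k.2
        · rfl
  have htrQ : ∀ N : Matrix n n ℝ, trace ((Qᵀ * N * Q) * (Qᵀ * N * Q)ᵀ) = trace (N * Nᵀ) := by
    intro N
    calc trace ((Qᵀ * N * Q) * (Qᵀ * N * Q)ᵀ) = trace (Qᵀ * (N * (Q * Qᵀ) * Nᵀ * Q)) := by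
          simp only [transpose_mul, transpose_transpose, Matrix.mul_assoc]
      _ = _ := by rw [trace_mul_comm, hQ2, Matrix.mul_one, Matrix.mul_assoc, hQ2, Matrix.mul_one]
  obtain ⟨α, β, P, R, hP, hR, hab, hcnt⟩ := theoremS_core a (η i0) θ
    (fun q => lt_of_le_of_ne (hi0 q) q.2)
    (by intro s; simp only [a, transpose_mul, transpose_transpose, diagonal_transpose, Matrix.mul_assoc])
    hdiag
    (by
      intro V hV
      have hV' : ∀ s, V s * (V s)ᵀ = 1 := fun s => mul_eq_one_comm.mp (hV s)
      have hmem : (fun s => Q * V s * Qᵀ * O s) ∈ {U : Fin 3 → Matrix n n ℝ | ∀ s, (U s)ᵀ * U s = 1} := by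
        intro s
        calc (Q * V s * Qᵀ * O s)ᵀ * (Q * V s * Qᵀ * O s)
            = (O s)ᵀ * (Q * ((V s)ᵀ * ((Qᵀ * Q) * (V s * (Qᵀ * O s))))) := by
              simp only [transpose_mul, transpose_transpose, Matrix.mul_assoc]
          _ = (O s)ᵀ * (Q * (((V s)ᵀ * V s) * (Qᵀ * O s))) := by rw [hQ1, Matrix.one_mul, Matrix.mul_assoc (V s)ᵀ]
          _ = (O s)ᵀ * ((Q * Qᵀ) * O s) := by rw [hV, Matrix.one_mul, Matrix.mul_assoc Q]
          _ = 1 := by rw [hQ2, Matrix.one_mul, hO]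
      have h := hOmin hmem
      simp only [Set.mem_ofPred_eq] at h
      rw [hsum, htrQ]
      refine h.trans (le_of_eq ?_)
      rw [← htrQ]
      have : Qᵀ * (∑ s, Q * V s * Qᵀ * O s * diagonal (d s) * (Q * V s * Qᵀ * O s)ᵀ) * Q = ∑ s, V s * a s * (V s)ᵀ := by
        rw [Matrix.mul_sum, Matrix.sum_mul]
        refine Finset.sum_congr rfl fun s _ => ?_
        calc Qᵀ * (Q * V s * Qᵀ * O s * diagonal (d s) * (Q * V s * Qᵀ * O s)ᵀ) * Q
            = (Qᵀ * Q) * (V s * a s * (V s)ᵀ) * (Qᵀ * Q) := by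
              simp only [a, transpose_mul, transpose_transpose, Matrix.mul_assoc]
          _ = _ := by rw [hQ1, Matrix.one_mul, Matrix.mul_one]
      rw [this])
  have hdb : diagonal (Sum.elim (fun _ : κ => η i0) θ) = fromBlocks (η i0 • (1 : Matrix κ κ ℝ)) 0 0 (diagonal θ) := by
    rw [← fromBlocks_diagonal]
    congr 1
    rw [← diagonal_one, ← diagonal_smul]
    congr 1
    funext i; simp
  have hblk : fromBlocks (∑ s, P s * diagonal (α s) * (P s)ᵀ) 0 0 (∑ s, R s * diagonal (β s) * (R s)ᵀ)
      = fromBlocks (η i0 • (1 : Matrix κ κ ℝ)) 0 0 (diagonal θ) := by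
    rw [← hdb, ← hdiag]
    simp only [hab, Fin.sum_univ_three, fromBlocks_add, add_zero]
  obtain ⟨hb1, -, -, hb2⟩ := fromBlocks_inj.mp hblk
  have hch : ∀ s, ∃ e : κ ⊕ lam ≃ n, Sum.elim (α s) (β s) = d s ∘ e := by
    intro s
    apply equiv_of_prod_eq
    rw [← charpoly_diagonal, ← charpoly_diagonal]
    have c1 : (a s).charpoly = (diagonal (d s)).charpoly := by
      rw [charpoly_conj_rect e0 Q hQ2]
      have := charpoly_conj_rect (Equiv.refl n) (O s)ᵀ (by rw [transpose_transpose]; exact hO s) (diagonal (d s))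
      rw [transpose_transpose] at this
      exact this
    have c2 : (a s).charpoly = (diagonal (Sum.elim (α s) (β s))).charpoly := by
      have hB : a s = ((fromBlocks (P s) 0 0 (R s))ᵀ)ᵀ * diagonal (Sum.elim (α s) (β s)) * (fromBlocks (P s) 0 0 (R s))ᵀ := by
        rw [hab s, transpose_transpose, ← fromBlocks_diagonal, fromBlocks_transpose]
        simp only [fromBlocks_multiply, Matrix.zero_mul, Matrix.mul_zero, add_zero, zero_add, transpose_zero]
      rw [hB, charpoly_conj_rect (Equiv.refl _)]
      rw [transpose_transpose, fromBlocks_transpose, fromBlocks_multiply]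
      simp [hP, hR]
    rw [← c1, ← c2]
  choose e he using hch
  refine ⟨κ, lam, inferInstance, inferInstance, inferInstance, inferInstance, ⟨⟨i0, rfl⟩⟩, α, β, P, R, η i0, θ, e, O, hP, hR, hO,
    (fun q => lt_of_le_of_ne (hi0 q) q.2), hb1, hb2, hcnt, he, ?_⟩
  rw [← hM, ← htrQ, ← hsum, hdiag]
  simp only [diagonal_transpose, diagonal_mul_diagonal, trace_diagonal, Fintype.sum_sum_type, Sum.elim_inl, Sum.elim_inr,
    Finset.sum_const, Finset.card_univ, nsmul_eq_mul, pow_two]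

end

section
open Matrix Topology Filter

/-- The bijection sending the two copies of `Fin p` to even and odd positions. -/
def evenOdd (p : ℕ) : Fin p ⊕ Fin p ≃ Fin (2 * p) where
  toFun := Sum.elim (fun i => ⟨2 * i.1, by have := i.2; omega⟩) (fun i => ⟨2 * i.1 + 1, by have := i.2; omega⟩)
  invFun := fun k => if k.1 % 2 = 0 then Sum.inl ⟨k.1 / 2, by have := k.2; omega⟩ else Sum.inr ⟨k.1 / 2, by have := k.2; omega⟩
  left_inv := by
    rintro (i | i)
    · simp
    · have h1 : (2 * i.1 + 1) % 2 = 1 := by omega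
      have h2 : (2 * i.1 + 1) / 2 = i.1 := by omega
      simp [h1, h2]
  right_inv := by
    intro k
    by_cases h : k.1 % 2 = 0
    · simp only [h, if_true, Sum.elim_inl]
      ext; simp; omega
    · simp only [h, if_false, Sum.elim_inr]
      ext; simp; omega

lemma evenOdd_sigma {p : ℕ} (σ : Fin (2 * p) → ℝ) : σ ∘ evenOdd p = Sum.elim (sminusR σ) (splusR σ) := by
  funext k
  rcases k with k | k <;> rfl

lemma evenOdd_dup {p : ℕ} (ν : Fin p → ℝ) : dupR ν ∘ evenOdd p = Sum.elim ν ν := by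
  funext k
  rcases k with k | k
  · simp [dupR, evenOdd]
  · simp only [dupR, evenOdd, Function.comp_apply, Equiv.coe_fn_mk, Sum.elim_inr]
    congr 1
    ext
    simp; omega

lemma count_pos {p : ℕ} {κ lam : Type} [Fintype κ] [Fintype lam] [DecidableEq κ]
    (e0 e1 : κ ⊕ lam ≃ Fin p) :
    (∑ q : lam, ∑ v : κ, ((if 2 * (e0 (Sum.inl v)).1 < 2 * (e1 (Sum.inr q)).1 + 1 then (1 : ℤ) else 0)
      + (if 2 * (e1 (Sum.inl v)).1 + 1 < 2 * (e0 (Sum.inr q)).1 then (1 : ℤ) else 0)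
      - (if 2 * (e0 (Sum.inl v)).1 < 2 * (e0 (Sum.inr q)).1 then (1 : ℤ) else 0)
      - (if 2 * (e1 (Sum.inl v)).1 + 1 < 2 * (e1 (Sum.inr q)).1 + 1 then (1 : ℤ) else 0))) = 0 := by
  set g : κ ⊕ lam → κ → ℤ := fun x v => ((if 2 * (e0 (Sum.inl v)).1 < 2 * (e1 x).1 + 1 then (1 : ℤ) else 0)
      + (if 2 * (e1 (Sum.inl v)).1 + 1 < 2 * (e0 x).1 then (1 : ℤ) else 0)
      - (if 2 * (e0 (Sum.inl v)).1 < 2 * (e0 x).1 then (1 : ℤ) else 0)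
      - (if 2 * (e1 (Sum.inl v)).1 + 1 < 2 * (e1 x).1 + 1 then (1 : ℤ) else 0)) with hg
  change ∑ q : lam, ∑ v : κ, g (Sum.inr q) v = 0
  have h1 : ∀ v, ∑ x, g x v = 1 := by
    intro v
    have r1 := Equiv.sum_comp e1 (fun i : Fin p => if 2 * (e0 (Sum.inl v)).1 < 2 * i.1 + 1 then (1 : ℤ) else 0)
    have r2 := Equiv.sum_comp e0 (fun i : Fin p => if 2 * (e1 (Sum.inl v)).1 + 1 < 2 * i.1 then (1 : ℤ) else 0)
    have r3 := Equiv.sum_comp e0 (fun i : Fin p => if 2 * (e0 (Sum.inl v)).1 < 2 * i.1 then (1 : ℤ) else 0)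
    have r4 := Equiv.sum_comp e1 (fun i : Fin p => if 2 * (e1 (Sum.inl v)).1 + 1 < 2 * i.1 + 1 then (1 : ℤ) else 0)
    simp only [hg, Finset.sum_sub_distrib, Finset.sum_add_distrib]
    rw [r1, r2, r3, r4, ← Finset.sum_add_distrib, ← Finset.sum_sub_distrib, ← Finset.sum_sub_distrib]
    refine Eq.trans ?_ (Finset.sum_ite_eq Finset.univ (e0 (Sum.inl v)) (fun _ => (1 : ℤ)) |>.trans (if_pos (Finset.mem_univ _)))
    refine Finset.sum_congr rfl fun i _ => ?_
    have : (e0 (Sum.inl v) = i) ↔ (e0 (Sum.inl v)).1 = i.1 := Fin.ext_iff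
    simp only [this]
    split_ifs <;> omega
  have h2 : 2 * ∑ u : κ, ∑ v : κ, g (Sum.inl u) v = 2 * Fintype.card κ := by
    rw [two_mul]
    nth_rewrite 2 [Finset.sum_comm]
    rw [← Finset.sum_add_distrib]
    have : ∀ u : κ, ∑ v : κ, g (Sum.inl u) v + ∑ v : κ, g (Sum.inl v) u = 2 := by
      intro u
      rw [← Finset.sum_add_distrib]
      refine Eq.trans ?_ (Finset.sum_ite_eq Finset.univ u (fun _ => (2 : ℤ)) |>.trans (if_pos (Finset.mem_univ _)))
      refine Finset.sum_congr rfl fun v _ => ?_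
      have a0 : (u = v) ↔ (e0 (Sum.inl u)).1 = (e0 (Sum.inl v)).1 := by
        rw [← Fin.ext_iff]; simp
      have a1 : (u = v) ↔ (e1 (Sum.inl u)).1 = (e1 (Sum.inl v)).1 := by
        rw [← Fin.ext_iff]; simp
      have a2 : (e0 (Sum.inl u)).1 = (e0 (Sum.inl v)).1 ↔ (e1 (Sum.inl u)).1 = (e1 (Sum.inl v)).1 := a0.symm.trans a1
      simp only [hg, a0]
      split_ifs <;> omega
    simp only [this, Finset.sum_const, Finset.card_univ, nsmul_eq_mul]
    ring
  have h3 : ∑ v : κ, ∑ x, g x v = Fintype.card κ := by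
    simp [h1]
  rw [Finset.sum_comm] at h3
  rw [Fintype.sum_sum_type] at h3
  linarith

/-- Indicator of `x < y`, as an integer. -/
noncomputable def ltInd (x y : ℝ) : ℤ := if x < y then 1 else 0

lemma card_sum_ite {A B : Type} [Fintype A] [Fintype B] (α : Fin 3 → A → ℝ) (β : Fin 3 → B → ℝ)
    [Fintype {x : Fin 3 × B × A // β x.1 x.2.1 < α x.1 x.2.2}] :
    ((Fintype.card {x : Fin 3 × B × A // β x.1 x.2.1 < α x.1 x.2.2} : ℕ) : ℤ)
      = ∑ s, ∑ q, ∑ v, ltInd (β s q) (α s v) := by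
  classical
  rw [Fintype.card_subtype, Finset.card_filter]
  push_cast
  rw [Fintype.sum_prod_type]
  refine Finset.sum_congr rfl fun s _ => ?_
  rw [Fintype.sum_prod_type]
  rfl

lemma count_double {p : ℕ} {κ lam : Type} [Fintype κ] [Fintype lam] [DecidableEq κ]
    (σ : Fin (2 * p) → ℝ) (hσ : StrictAnti σ) (e0 e1 : κ ⊕ lam ≃ Fin p)
    (α : Fin 3 → κ → ℝ) (β : Fin 3 → lam → ℝ)
    (h0 : Sum.elim (α 0) (β 0) = sminusR σ ∘ e0) (h1 : Sum.elim (α 1) (β 1) = splusR σ ∘ e1)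
    [Fintype {x : Fin 3 × lam × κ // β x.1 x.2.1 < α x.1 x.2.2}]
    [Fintype {x : Fin 3 × (lam ⊕ lam) × (κ ⊕ κ) //
      Sum.elim (β x.1) (β (Equiv.swap 0 1 x.1)) x.2.1 < Sum.elim (α x.1) (α (Equiv.swap 0 1 x.1)) x.2.2}]
    (hc : Fintype.card {x : Fin 3 × lam × κ // β x.1 x.2.1 < α x.1 x.2.2} ≤ Fintype.card lam * Fintype.card κ) :
    Fintype.card {x : Fin 3 × (lam ⊕ lam) × (κ ⊕ κ) //
      Sum.elim (β x.1) (β (Equiv.swap 0 1 x.1)) x.2.1 < Sum.elim (α x.1) (α (Equiv.swap 0 1 x.1)) x.2.2}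
      ≤ Fintype.card (lam ⊕ lam) * Fintype.card (κ ⊕ κ) := by
  have hc' : (Fintype.card {x : Fin 3 × lam × κ // β x.1 x.2.1 < α x.1 x.2.2} : ℤ) ≤ Fintype.card lam * Fintype.card κ := by
    exact_mod_cast hc
  rw [card_sum_ite] at hc'
  zify
  rw [card_sum_ite (fun s => Sum.elim (α s) (α (Equiv.swap 0 1 s))) (fun s => Sum.elim (β s) (β (Equiv.swap 0 1 s)))]
  have s2 : (Equiv.swap (0 : Fin 3) 1) 2 = 2 := by decide
  simp only [Fin.sum_univ_three, Fintype.sum_sum_type, Sum.elim_inl, Sum.elim_inr, Equiv.swap_apply_left,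
    Equiv.swap_apply_right, s2, Fintype.card_sum, Finset.sum_add_distrib] at hc' ⊢
  have key := count_pos e0 e1
  have a0 : ∀ v, α 0 v = σ ⟨2 * (e0 (Sum.inl v)).1, by have := (e0 (Sum.inl v)).2; omega⟩ := fun v => congrFun h0 (Sum.inl v)
  have a1 : ∀ v, α 1 v = σ ⟨2 * (e1 (Sum.inl v)).1 + 1, by have := (e1 (Sum.inl v)).2; omega⟩ := fun v => congrFun h1 (Sum.inl v)
  have b0 : ∀ v, β 0 v = σ ⟨2 * (e0 (Sum.inr v)).1, by have := (e0 (Sum.inr v)).2; omega⟩ := fun v => congrFun h0 (Sum.inr v)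
  have b1 : ∀ v, β 1 v = σ ⟨2 * (e1 (Sum.inr v)).1 + 1, by have := (e1 (Sum.inr v)).2; omega⟩ := fun v => congrFun h1 (Sum.inr v)
  have l10 : ∀ q v, β 1 q < α 0 v ↔ 2 * (e0 (Sum.inl v)).1 < 2 * (e1 (Sum.inr q)).1 + 1 := by
    intro q v; rw [a0, b1, hσ.lt_iff_gt, Fin.mk_lt_mk]
  have l01 : ∀ q v, β 0 q < α 1 v ↔ 2 * (e1 (Sum.inl v)).1 + 1 < 2 * (e0 (Sum.inr q)).1 := by
    intro q v; rw [a1, b0, hσ.lt_iff_gt, Fin.mk_lt_mk]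
  have l00 : ∀ q v, β 0 q < α 0 v ↔ 2 * (e0 (Sum.inl v)).1 < 2 * (e0 (Sum.inr q)).1 := by
    intro q v; rw [a0, b0, hσ.lt_iff_gt, Fin.mk_lt_mk]
  have l11 : ∀ q v, β 1 q < α 1 v ↔ 2 * (e1 (Sum.inl v)).1 + 1 < 2 * (e1 (Sum.inr q)).1 + 1 := by
    intro q v; rw [a1, b1, hσ.lt_iff_gt, Fin.mk_lt_mk]
  have key' : ∑ q, ∑ v, (ltInd (β 1 q) (α 0 v) + ltInd (β 0 q) (α 1 v)
      - ltInd (β 0 q) (α 0 v) - ltInd (β 1 q) (α 1 v)) = 0 := by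
    refine Eq.trans ?_ key
    refine Finset.sum_congr rfl fun q _ => Finset.sum_congr rfl fun v _ => ?_
    unfold ltInd
    rw [if_congr (l10 q v) rfl rfl, if_congr (l01 q v) rfl rfl, if_congr (l00 q v) rfl rfl, if_congr (l11 q v) rfl rfl]
  simp only [Finset.sum_add_distrib, Finset.sum_sub_distrib] at key'
  push_cast
  linarith

lemma fromBlocks_orth {κ : Type} [Fintype κ] [DecidableEq κ] (P P' : Matrix κ κ ℝ) (h : Pᵀ * P = 1) (h' : P'ᵀ * P' = 1) :
    (fromBlocks P 0 0 P')ᵀ * fromBlocks P 0 0 P' = 1 := by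
  rw [fromBlocks_transpose, fromBlocks_multiply]
  simp [h, h']

lemma fromBlocks_sum_conj {κ : Type} [Fintype κ] [DecidableEq κ] (P : Fin 3 → Matrix κ κ ℝ) (α : Fin 3 → κ → ℝ)
    (M : Matrix κ κ ℝ) (h : ∑ s, P s * diagonal (α s) * (P s)ᵀ = M) :
    ∑ s, fromBlocks (P s) 0 0 (P (Equiv.swap 0 1 s)) * diagonal (Sum.elim (α s) (α (Equiv.swap 0 1 s)))
      * (fromBlocks (P s) 0 0 (P (Equiv.swap 0 1 s)))ᵀ = fromBlocks M 0 0 M := by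
  have h' : ∑ s, P (Equiv.swap 0 1 s) * diagonal (α (Equiv.swap 0 1 s)) * (P (Equiv.swap 0 1 s))ᵀ = M := by
    rw [← h]
    exact Equiv.sum_comp (Equiv.swap 0 1) (fun s => P s * diagonal (α s) * (P s)ᵀ)
  have : ∀ s, fromBlocks (P s) 0 0 (P (Equiv.swap 0 1 s)) * diagonal (Sum.elim (α s) (α (Equiv.swap 0 1 s)))
      * (fromBlocks (P s) 0 0 (P (Equiv.swap 0 1 s)))ᵀ
      = fromBlocks (P s * diagonal (α s) * (P s)ᵀ) 0 0
        (P (Equiv.swap 0 1 s) * diagonal (α (Equiv.swap 0 1 s)) * (P (Equiv.swap 0 1 s))ᵀ) := by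
    intro s
    rw [← fromBlocks_diagonal, fromBlocks_transpose]
    simp only [fromBlocks_multiply, Matrix.zero_mul, Matrix.mul_zero, add_zero, zero_add, transpose_zero]
  simp only [this]
  nth_rewrite 1 [← h]
  rw [← h']
  simp only [Fin.sum_univ_three, fromBlocks_add, add_zero]

end

section
open Matrix Topology Filter

lemma trace_conj_sum {κ : Type} [Fintype κ] [DecidableEq κ] (P : Fin 3 → Matrix κ κ ℝ) (hP : ∀ s, (P s)ᵀ * P s = 1)
    (α : Fin 3 → κ → ℝ) : trace (∑ s, P s * diagonal (α s) * (P s)ᵀ) = ∑ s, ∑ v, α s v := by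
  rw [trace_sum]
  refine Finset.sum_congr rfl fun s _ => ?_
  rw [trace_mul_comm, ← Matrix.mul_assoc, hP, Matrix.one_mul, trace_diagonal]

lemma submatrix_conj {A B : Type} [Fintype A] [Fintype B] [DecidableEq A] [DecidableEq B] (h f : A ≃ B)
    (G : Matrix B B ℂ) (D : B → ℂ) :
    G.submatrix h f * diagonal (D ∘ f) * (G.submatrix h f)ᴴ = (G * diagonal D * Gᴴ).submatrix h h := by
  rw [conjTranspose_submatrix, ← Matrix.submatrix_diagonal_equiv, Matrix.submatrix_mul_equiv, Matrix.submatrix_mul_equiv]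

theorem theoremD {p : ℕ} (hp : 0 < p) (σ : Fin (2 * p) → ℝ) (hσ : StrictAnti σ) (ν : Fin p → ℝ)
    (d : Fin 3 → Fin p → ℝ) (hd0 : d 0 = sminusR σ) (hd1 : d 1 = splusR σ) (hd2 : d 2 = fun i => - ν i)
    (D : Fin 3 → Fin (2 * p) → ℝ) (hD0 : D 0 = σ) (hD1 : D 1 = σ) (hD2 : D 2 = fun i => - dupR ν i) :
    ∃ (κ lam : Type) (_ : Fintype κ) (_ : Fintype lam) (_ : Nonempty κ) (μ : ℝ) (θ : lam → ℝ)
      (O : Fin 3 → Matrix (Fin p) (Fin p) ℝ),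
      (∀ s, (O s)ᵀ * O s = 1) ∧ (∀ q, θ q < μ) ∧ Fintype.card κ + Fintype.card lam = p ∧
      (Fintype.card κ * μ + ∑ q, θ q = ∑ s, ∑ i, d s i) ∧
      trace ((∑ s, O s * diagonal (d s) * (O s)ᵀ) * (∑ s, O s * diagonal (d s) * (O s)ᵀ)ᵀ)
        = Fintype.card κ * μ ^ 2 + ∑ q, θ q ^ 2 ∧
      ∀ G : Fin 3 → Matrix (Fin (2 * p)) (Fin (2 * p)) ℂ, (∀ s, (G s)ᴴ * G s = 1) →
        ∃ U : Matrix (Fin (2 * p)) (κ ⊕ κ) ℂ, (∃ h : DecidableEq (κ ⊕ κ), Uᴴ * U = (1 : Matrix (κ ⊕ κ) (κ ⊕ κ) ℂ)) ∧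
          μ * Fintype.card (κ ⊕ κ) ≤ (trace (Uᴴ * (∑ s, G s * diagonal (fun k => ((D s k : ℝ) : ℂ)) * (G s)ᴴ) * U)).re := by
  classical
  have : Nonempty (Fin p) := ⟨⟨0, hp⟩⟩
  obtain ⟨κ, lam, i1, i2, i3, i4, i5, α, β, P, R, μ, θ, e, O, hP, hR, hO, hθ, h1, h2, hc, he, htr⟩ := theoremS d
  refine ⟨κ, lam, i1, i2, i5, μ, θ, O, hO, hθ, ?_, ?_, htr, ?_⟩
  · rw [← Fintype.card_sum, Fintype.card_congr (e 0), Fintype.card_fin]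
  · have t1 := congrArg trace h1
    have t2 := congrArg trace h2
    rw [trace_conj_sum P hP, trace_smul, trace_one] at t1
    rw [trace_conj_sum R hR, trace_diagonal] at t2
    rw [← t2, mul_comm, ← smul_eq_mul, ← t1, ← Finset.sum_add_distrib]
    refine Finset.sum_congr rfl fun s _ => ?_
    rw [← Equiv.sum_comp (e s) (d s), Fintype.sum_sum_type]
    have := he s
    congr 1
    · exact Finset.sum_congr rfl fun v _ => congrFun (he s) (Sum.inl v)
    · exact Finset.sum_congr rfl fun v _ => congrFun (he s) (Sum.inr v)
  · intro G hG
    let α' : Fin 3 → κ ⊕ κ → ℝ := fun s => Sum.elim (α s) (α (Equiv.swap 0 1 s))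
    let β' : Fin 3 → lam ⊕ lam → ℝ := fun s => Sum.elim (β s) (β (Equiv.swap 0 1 s))
    have hF : ∀ s, ∃ f : Fin p ⊕ Fin p ≃ Fin (2 * p), Sum.elim (d s) (d (Equiv.swap 0 1 s)) = D s ∘ f := by
      intro s
      have s2 : (Equiv.swap (0 : Fin 3) 1) 2 = 2 := by decide
      fin_cases s
      · refine ⟨evenOdd p, ?_⟩
        simp only [Fin.zero_eta, Equiv.swap_apply_left]
        rw [hD0, evenOdd_sigma, hd0, hd1]
      · refine ⟨(Equiv.sumComm _ _).trans (evenOdd p), ?_⟩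
        simp only [Fin.mk_one, Equiv.swap_apply_right]
        rw [hD1, Equiv.coe_trans, ← Function.comp_assoc, evenOdd_sigma, hd0, hd1]
        funext k
        rcases k with k | k <;> rfl
      · refine ⟨evenOdd p, ?_⟩
        change Sum.elim (d 2) (d ((Equiv.swap 0 1) 2)) = D 2 ∘ evenOdd p
        rw [s2, hd2, hD2]
        have := evenOdd_dup ν
        funext k
        have := congrFun this k
        simp only [Function.comp_apply] at this ⊢
        rw [this]
        rcases k with k | k <;> rfl
    choose f hf using hF
    let E : Fin 3 → ((κ ⊕ κ) ⊕ (lam ⊕ lam) ≃ Fin (2 * p)) := fun s =>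
      (Equiv.sumSumSumComm κ κ lam lam).trans ((Equiv.sumCongr (e s) (e (Equiv.swap 0 1 s))).trans (f s))
    have hE : ∀ s, Sum.elim (α' s) (β' s) = D s ∘ E s := by
      intro s
      have hh : D s ∘ E s = (D s ∘ f s) ∘ (Equiv.sumCongr (e s) (e (Equiv.swap 0 1 s))) ∘ (Equiv.sumSumSumComm κ κ lam lam) := rfl
      rw [hh, ← hf s]
      funext k
      rcases k with (k | k) | (k | k)
      · exact congrFun (he s) (Sum.inl k)
      · exact congrFun (he (Equiv.swap 0 1 s)) (Sum.inl k)
      · exact congrFun (he s) (Sum.inr k)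
      · exact congrFun (he (Equiv.swap 0 1 s)) (Sum.inr k)
    obtain ⟨U, hU, hUt⟩ := theoremT α' β' (fun s => fromBlocks (P s) 0 0 (P (Equiv.swap 0 1 s)))
      (fun s => fromBlocks (R s) 0 0 (R (Equiv.swap 0 1 s)))
      (fun s => fromBlocks_orth _ _ (hP _) (hP _)) (fun s => fromBlocks_orth _ _ (hR _) (hR _)) μ
      (by
        rw [fromBlocks_sum_conj P α _ h1]
        rw [← fromBlocks_one, fromBlocks_smul]
        simp)
      (by
        rw [fromBlocks_sum_conj R β _ h2, fromBlocks_diagonal, ← diagonal_one, ← diagonal_smul, diagonal_sub]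
        rw [posDef_diagonal_iff]
        rintro (q | q) <;> simp [hθ q])
      (by
        convert count_double σ hσ (e 0) (e 1) α β (by rw [← hd0]; exact he 0) (by rw [← hd1]; exact he 1) hc)
      (fun s => (G s).submatrix (E 0) (E s))
      (by
        intro s
        rw [conjTranspose_submatrix, Matrix.submatrix_mul_equiv, hG]
        simp)
    have hM : ∑ s, (G s).submatrix (E 0) (E s) * diagonal (fun k => ((Sum.elim (α' s) (β' s) k : ℝ) : ℂ)) * ((G s).submatrix (E 0) (E s))ᴴ
        = (∑ s, G s * diagonal (fun k => ((D s k : ℝ) : ℂ)) * (G s)ᴴ).submatrix (E 0) (E 0) := by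
      have : ∀ s, (fun k => ((Sum.elim (α' s) (β' s) k : ℝ) : ℂ)) = (fun k => ((D s k : ℝ) : ℂ)) ∘ E s := by
        intro s; rw [hE]; rfl
      simp only [this, submatrix_conj]
      simp only [Fin.sum_univ_three, Matrix.submatrix_add, Pi.add_apply]
    rw [hM] at hUt
    obtain ⟨W, rfl⟩ : ∃ W : Matrix (Fin (2 * p)) (κ ⊕ κ) ℂ, U = W.submatrix (E 0) id := ⟨U.submatrix (E 0).symm id, by simp⟩
    rw [conjTranspose_submatrix, Matrix.submatrix_mul_equiv] at hU
    rw [conjTranspose_submatrix, Matrix.submatrix_mul_equiv, Matrix.submatrix_mul_equiv] at hUt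
    rw [Matrix.submatrix_id_id] at hU hUt
    exact ⟨W, ⟨inferInstance, hU⟩, hUt⟩

end

section
open Matrix Topology Filter

lemma diag_of_spec {n : Type} [Fintype n] [DecidableEq n] (A : Matrix n n ℝ) (hA : Aᵀ = A) (m : n → ℝ)
    (h : A.charpoly = ∏ i, (Polynomial.X - Polynomial.C (m i))) :
    ∃ O : Matrix n n ℝ, Oᵀ * O = 1 ∧ A = O * diagonal m * Oᵀ := by
  obtain ⟨Q, d, hQ, hAQ⟩ := symm_diag A hA
  have c1 : A.charpoly = (diagonal d).charpoly := by
    have := charpoly_conj_rect (Equiv.refl n) Qᵀ (by rw [transpose_transpose]; exact hQ) (diagonal d)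
    rw [transpose_transpose] at this
    rw [hAQ, this]
  rw [h, charpoly_diagonal] at c1
  obtain ⟨e, he⟩ := equiv_of_prod_eq d m c1.symm
  obtain ⟨W, rfl⟩ : ∃ W : Matrix n n ℝ, Q = W.submatrix id e := ⟨Q.submatrix id e.symm, by simp⟩
  have hW : W * Wᵀ = 1 := by
    have := mul_eq_one_comm.mp hQ
    rwa [transpose_submatrix, Matrix.submatrix_mul_equiv, Matrix.submatrix_id_id] at this
  refine ⟨W, mul_eq_one_comm.mp hW, ?_⟩
  rw [hAQ, he, ← Matrix.submatrix_diagonal_equiv, transpose_submatrix, Matrix.submatrix_mul_equiv, Matrix.submatrix_mul_equiv,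
    Matrix.submatrix_id_id]

lemma quad_le {I κ : Type} [Fintype I] [Fintype κ] [DecidableEq I] [DecidableEq κ] (G : Matrix I I ℂ) (hG : Gᴴ * G = 1)
    (U : Matrix I κ ℂ) (hU : Uᴴ * U = 1) (w : I → ℝ) (c : ℝ) (hw : ∀ i, w i ≤ c) :
    (trace (Uᴴ * (G * diagonal (fun k => ((w k : ℝ) : ℂ)) * Gᴴ) * U)).re ≤ c * Fintype.card κ := by
  have hG' : G * Gᴴ = 1 := mul_eq_one_comm.mp hG
  have hY : (Gᴴ * U)ᴴ * (Gᴴ * U) = 1 := by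
    rw [conjTranspose_mul, conjTranspose_conjTranspose, Matrix.mul_assoc, ← Matrix.mul_assoc G, hG', Matrix.one_mul, hU]
  have : Uᴴ * (G * diagonal (fun k => ((w k : ℝ) : ℂ)) * Gᴴ) * U
      = (Gᴴ * U)ᴴ * diagonal (fun k => ((w k : ℝ) : ℂ)) * (Gᴴ * U) := by
    simp only [conjTranspose_mul, conjTranspose_conjTranspose, Matrix.mul_assoc]
  rw [this, diag_quad_re]
  calc ∑ v, ∑ k, w k * ‖(Gᴴ * U) k v‖ ^ 2 ≤ ∑ v, ∑ k, c * ‖(Gᴴ * U) k v‖ ^ 2 :=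
        Finset.sum_le_sum fun v _ => Finset.sum_le_sum fun k _ => mul_le_mul_of_nonneg_right (hw k) (by positivity)
    _ = c * Fintype.card κ := by
        simp only [← Finset.mul_sum, col_norm _ hY]
        simp

/-- The centred strictly decreasing weight used for perturbation. -/
noncomputable def wt (p : ℕ) : Fin (2 * p) → ℝ := fun i => (2 * p - 1) / 2 - i.1

lemma wt_sum (p : ℕ) : ∑ i, wt p i = 0 := by
  unfold wt
  rw [Finset.sum_sub_distrib, Finset.sum_const, Finset.card_univ, Fintype.card_fin, nsmul_eq_mul]
  have h : ∑ i : Fin (2 * p), ((i.1 : ℕ) : ℝ) = ∑ i ∈ Finset.range (2 * p), (i : ℝ) := Fin.sum_univ_eq_sum_range (fun i => (i : ℝ)) _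
  have h2 : ∀ m : ℕ, ∑ i ∈ Finset.range m, (i : ℝ) = m * (m - 1) / 2 := by
    intro m
    induction m with
    | zero => simp
    | succ k ih => rw [Finset.sum_range_succ, ih]; push_cast; ring
  rw [h, h2]
  push_cast
  ring

/-- The perturbed spectra. -/
noncomputable def sg {p : ℕ} (σ : Fin (2 * p) → ℝ) (ε : ℝ) : Fin (2 * p) → ℝ := fun i => σ i + ε * wt p i

/-- The three half-size spectra. -/
noncomputable def dd {p : ℕ} (σ : Fin (2 * p) → ℝ) (ν : Fin p → ℝ) (ε : ℝ) : Fin 3 → Fin p → ℝ :=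
  ![sminusR (sg σ ε), splusR (sg σ ε), fun i => - ν i]

lemma sum_even_odd {p : ℕ} (f : Fin (2 * p) → ℝ) : ∑ i, f i = ∑ i, sminusR f i + ∑ i, splusR f i := by
  rw [← Equiv.sum_comp (evenOdd p) f, Fintype.sum_sum_type]
  rfl

lemma sum_dup {p : ℕ} (ν : Fin p → ℝ) : ∑ i, dupR ν i = 2 * ∑ i, ν i := by
  have h := evenOdd_dup ν
  rw [← Equiv.sum_comp (evenOdd p) (dupR ν)]
  change ∑ i, (dupR ν ∘ evenOdd p) i = _
  rw [h, Fintype.sum_sum_type]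
  simp only [Sum.elim_inl, Sum.elim_inr]
  ring

lemma sum_bound {lam : Type} [Fintype lam] (k p : ℕ) (μ δ : ℝ) (θ : lam → ℝ) (hk : k + Fintype.card lam = p) (hp : 0 < p)
    (hθ : ∀ q, θ q < μ) (hs : k * μ + ∑ q, θ q = 0) (hμ : μ ≤ δ) :
    k * μ ^ 2 + ∑ q, θ q ^ 2 ≤ p * (p * δ) ^ 2 := by
  have h1 : ∑ q, (μ - θ q) = p * μ := by
    rw [Finset.sum_sub_distrib, Finset.sum_const, Finset.card_univ, nsmul_eq_mul, ← hk]
    push_cast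
    linarith
  have h2 : ∀ q, μ - θ q ≤ p * μ := by
    intro q
    rw [← h1]
    exact Finset.single_le_sum (f := fun q => μ - θ q) (fun q _ => by linarith [hθ q]) (Finset.mem_univ q)
  have hp' : (1 : ℝ) ≤ p := by exact_mod_cast hp
  have h3 : 0 ≤ p * μ := by
    rw [← h1]
    exact Finset.sum_nonneg fun q _ => by linarith [hθ q]
  have h4 : 0 ≤ μ := by
    by_contra hneg
    push Not at hneg
    nlinarith
  have h5 : p * μ ≤ p * δ := mul_le_mul_of_nonneg_left hμ (by linarith)
  have h6 : ∀ q, θ q ^ 2 ≤ (p * δ) ^ 2 := by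
    intro q
    apply sq_le_sq'
    · linarith [h2 q]
    · have := hθ q; nlinarith
  have h7 : μ ^ 2 ≤ (p * δ) ^ 2 := by
    apply sq_le_sq'
    · linarith
    · nlinarith
  calc k * μ ^ 2 + ∑ q, θ q ^ 2 ≤ k * (p * δ) ^ 2 + ∑ q : lam, (p * δ) ^ 2 :=
        add_le_add (mul_le_mul_of_nonneg_left h7 (by positivity)) (Finset.sum_le_sum fun q _ => h6 q)
    _ = _ := by
      rw [Finset.sum_const, Finset.card_univ, nsmul_eq_mul, ← hk]
      push_cast
      ring

lemma toC_orth {n : Type} [Fintype n] [DecidableEq n] (O : Matrix n n ℝ) (h : Oᵀ * O = 1) :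
    (O.map Complex.ofRealHom)ᴴ * O.map Complex.ofRealHom = 1 := by
  have h1 : (O.map Complex.ofRealHom)ᴴ = Oᵀ.map Complex.ofRealHom := by
    ext i j; simp
  rw [h1, ← Matrix.map_mul, h]
  simp

lemma toC_conj {n : Type} [Fintype n] [DecidableEq n] (O : Matrix n n ℝ) (f : n → ℝ) :
    (O.map Complex.ofRealHom) * diagonal (fun k => ((f k : ℝ) : ℂ)) * (O.map Complex.ofRealHom)ᴴ
      = (O * diagonal f * Oᵀ).map Complex.ofRealHom := by
  have h1 : (O.map Complex.ofRealHom)ᴴ = Oᵀ.map Complex.ofRealHom := by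
    ext i j; simp
  rw [h1, Matrix.map_mul, Matrix.map_mul, diagonal_map (map_zero _)]
  rfl

theorem hard_eps {p : ℕ} (hp : 0 < p) (σ : Fin (2 * p) → ℝ) (hσ : Antitone σ) (ν : Fin p → ℝ)
    (OA OB OC : Matrix (Fin (2 * p)) (Fin (2 * p)) ℝ) (hA : OAᵀ * OA = 1) (hB : OBᵀ * OB = 1) (hC : OCᵀ * OC = 1)
    (h : OA * diagonal σ * OAᵀ + OB * diagonal σ * OBᵀ = OC * diagonal (dupR ν) * OCᵀ) (ε : ℝ) (hε : 0 < ε) :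
    ∃ O : Fin 3 → Matrix (Fin p) (Fin p) ℝ, (∀ s, (O s)ᵀ * O s = 1) ∧
      trace ((∑ s, O s * diagonal (dd σ ν ε s) * (O s)ᵀ) * (∑ s, O s * diagonal (dd σ ν ε s) * (O s)ᵀ)ᵀ)
        ≤ p * (p * (2 * p * ε)) ^ 2 := by
  have hstrict : StrictAnti (sg σ ε) := by
    intro i j hij
    have h1 := hσ hij.le
    have h2 : ((i.1 : ℕ) : ℝ) < (j.1 : ℕ) := by exact_mod_cast hij
    simp only [sg, wt]
    nlinarith
  obtain ⟨κ, lam, i1, i2, i3, μ, θ, O, hO, hθ, hcard, hsum, htr, hG⟩ := theoremD hp (sg σ ε) hstrict ν (dd σ ν ε) rfl rfl rfl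
    ![sg σ ε, sg σ ε, fun i => - dupR ν i] rfl rfl rfl
  refine ⟨O, hO, ?_⟩
  rw [htr]
  have hs0 : ∑ s, ∑ i, dd σ ν ε s i = 0 := by
    have e1 : ∑ i, sg σ ε i = ∑ i, σ i := by
      simp only [sg, Finset.sum_add_distrib, ← Finset.mul_sum, wt_sum, mul_zero, add_zero]
    have e2 := congrArg trace h
    rw [trace_add, trace_mul_comm, ← Matrix.mul_assoc, hA, Matrix.one_mul, trace_mul_comm (OB * _), ← Matrix.mul_assoc, hB,
      Matrix.one_mul, trace_mul_comm (OC * _), ← Matrix.mul_assoc, hC, Matrix.one_mul, trace_diagonal, trace_diagonal, sum_dup] at e2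
    rw [sum_even_odd] at e1
    simp only [Fin.sum_univ_three, dd, Matrix.cons_val_zero, Matrix.cons_val_one, Matrix.cons_val, Finset.sum_neg_distrib]
    linarith
  refine sum_bound (Fintype.card κ) p μ _ θ hcard hp hθ (hsum.trans hs0) ?_
  obtain ⟨U, ⟨inst, hU⟩, hle⟩ := hG ![OA.map Complex.ofRealHom, OB.map Complex.ofRealHom, OC.map Complex.ofRealHom]
    (by
      intro s
      fin_cases s
      · exact toC_orth OA hA
      · exact toC_orth OB hB
      · exact toC_orth OC hC)
  have hmat : ∑ s, (![OA.map Complex.ofRealHom, OB.map Complex.ofRealHom, OC.map Complex.ofRealHom] : Fin 3 → Matrix (Fin (2 * p)) (Fin (2 * p)) ℂ) s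
      * diagonal (fun k => (((![sg σ ε, sg σ ε, fun i => - dupR ν i] : Fin 3 → Fin (2 * p) → ℝ) s k : ℝ) : ℂ))
      * ((![OA.map Complex.ofRealHom, OB.map Complex.ofRealHom, OC.map Complex.ofRealHom] : Fin 3 → Matrix (Fin (2 * p)) (Fin (2 * p)) ℂ) s)ᴴ
      = OA.map Complex.ofRealHom * diagonal (fun k => (((ε * wt p k) : ℝ) : ℂ)) * (OA.map Complex.ofRealHom)ᴴ
        + OB.map Complex.ofRealHom * diagonal (fun k => (((ε * wt p k) : ℝ) : ℂ)) * (OB.map Complex.ofRealHom)ᴴ := by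
    rw [Fin.sum_univ_three]
    simp only [Matrix.cons_val_zero, Matrix.cons_val_one, Matrix.cons_val]
    rw [toC_conj, toC_conj, toC_conj, toC_conj, toC_conj, ← Matrix.map_add _ (map_add _), ← Matrix.map_add _ (map_add _), ← Matrix.map_add _ (map_add _)]
    congr 1
    have d1 : diagonal (sg σ ε) = diagonal σ + diagonal (fun k => ε * wt p k) := by
      rw [diagonal_add]; rfl
    have d2 : diagonal (fun i => - dupR ν i) = - diagonal (dupR ν) := by
      rw [diagonal_neg]
    rw [d1, d2, Matrix.mul_add, Matrix.add_mul, Matrix.mul_add, Matrix.add_mul, Matrix.mul_neg, Matrix.neg_mul, ← h]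
    abel
  rw [hmat, Matrix.mul_add, Matrix.add_mul, trace_add, Complex.add_re] at hle
  have hw : ∀ i, ε * wt p i ≤ ε * p := by
    intro i
    refine mul_le_mul_of_nonneg_left ?_ hε.le
    unfold wt
    have : (0 : ℝ) ≤ (i.1 : ℕ) := by positivity
    linarith
  have q1 := quad_le _ (toC_orth OA hA) U hU _ _ hw
  have q2 := quad_le _ (toC_orth OB hB) U hU _ _ hw
  have hpos : (0 : ℝ) < Fintype.card (κ ⊕ κ) := by
    exact_mod_cast Fintype.card_pos
  have : μ * Fintype.card (κ ⊕ κ) ≤ (2 * p * ε) * Fintype.card (κ ⊕ κ) := by linarith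
  exact le_of_mul_le_mul_right this hpos

theorem hard_limit {p : ℕ} (hp : 0 < p) (σ : Fin (2 * p) → ℝ) (hσ : Antitone σ) (ν : Fin p → ℝ)
    (OA OB OC : Matrix (Fin (2 * p)) (Fin (2 * p)) ℝ) (hA : OAᵀ * OA = 1) (hB : OBᵀ * OB = 1) (hC : OCᵀ * OC = 1)
    (h : OA * diagonal σ * OAᵀ + OB * diagonal σ * OBᵀ = OC * diagonal (dupR ν) * OCᵀ) :
    ∃ O : Fin 3 → Matrix (Fin p) (Fin p) ℝ, (∀ s, (O s)ᵀ * O s = 1) ∧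
      ∑ s, O s * diagonal (dd σ ν 0 s) * (O s)ᵀ = 0 := by
  have hε : ∀ n : ℕ, (0 : ℝ) < 1 / ((n : ℝ) + 1) := fun n => Nat.one_div_pos_of_nat
  choose O hO hbd using fun n : ℕ => hard_eps hp σ hσ ν OA OB OC hA hB hC h _ (hε n)
  have fc : FirstCountableTopology (Fin 3 → Matrix (Fin p) (Fin p) ℝ) :=
    inferInstanceAs (FirstCountableTopology (Fin 3 → Fin p → Fin p → ℝ))
  obtain ⟨L, hL, φ, hφ, hlim⟩ := (compact_orth (n := Fin p)).tendsto_subseq (x := O) hO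
  refine ⟨L, hL, ?_⟩
  let F : ℝ × (Fin 3 → Matrix (Fin p) (Fin p) ℝ) → ℝ := fun x =>
    trace ((∑ s, x.2 s * diagonal (dd σ ν x.1 s) * (x.2 s)ᵀ) * (∑ s, x.2 s * diagonal (dd σ ν x.1 s) * (x.2 s)ᵀ)ᵀ)
  have hd : ∀ s, Continuous fun ε => dd σ ν ε s := by
    intro s
    refine continuous_pi fun i => ?_
    fin_cases s
    · change Continuous fun ε => σ _ + ε * wt p _
      fun_prop
    · change Continuous fun ε => σ _ + ε * wt p _
      fun_prop
    · exact continuous_const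
  have hF : Continuous F := by
    have : ∀ s, Continuous fun x : ℝ × (Fin 3 → Matrix (Fin p) (Fin p) ℝ) => diagonal (dd σ ν x.1 s) :=
      fun s => ((hd s).comp continuous_fst).matrix_diagonal
    fun_prop
  have h0 : Tendsto (fun n : ℕ => 1 / ((n : ℝ) + 1)) atTop (𝓝 0) := tendsto_one_div_add_atTop_nhds_zero_nat
  have h0' := h0.comp hφ.tendsto_atTop
  have hFlim : Tendsto (fun n => F (1 / ((φ n : ℝ) + 1), O (φ n))) atTop (𝓝 (F (0, L))) :=
    (hF.tendsto (0, L)).comp (h0'.prodMk_nhds hlim)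
  have hbl : Tendsto (fun n => (p : ℝ) * (p * (2 * p * (1 / ((φ n : ℝ) + 1)))) ^ 2) atTop (𝓝 ((p : ℝ) * (p * (2 * p * 0)) ^ 2)) :=
    (((h0'.const_mul _).const_mul _).pow 2).const_mul _
  have hle : F (0, L) ≤ 0 := by
    have := le_of_tendsto_of_tendsto' hFlim hbl (fun n => hbd (φ n))
    simpa using this
  set M := ∑ s, L s * diagonal (dd σ ν 0 s) * (L s)ᵀ with hM
  have hle' : trace (M * Mᵀ) ≤ 0 := hle
  have hge : 0 ≤ trace (M * Mᵀ) := by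
    simp only [trace, diag_apply, Matrix.mul_apply, transpose_apply]
    exact Finset.sum_nonneg fun i _ => Finset.sum_nonneg fun j _ => mul_self_nonneg _
  have hz := le_antisymm hle' hge
  rw [← conjTranspose_eq_transpose_of_trivial] at hz
  exact trace_mul_conjTranspose_self_eq_zero_iff.mp hz

lemma spec_conj {n : Type} [Fintype n] [DecidableEq n] (O : Matrix n n ℝ) (h : Oᵀ * O = 1) (m : n → ℝ) :
    (O * diagonal m * Oᵀ).charpoly = ∏ i, (Polynomial.X - Polynomial.C (m i)) := by
  have := charpoly_conj_rect (Equiv.refl n) Oᵀ (by rw [transpose_transpose]; exact h) (diagonal m)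
  rw [transpose_transpose] at this
  rw [this, charpoly_diagonal]

theorem hard_dir (p : ℕ)
    (σ : Fin (2 * p) → ℝ) (hσ : Antitone σ) (ν : Fin p → ℝ) (hν : Antitone ν)
    (h : ∃ A B : Matrix (Fin (2 * p)) (Fin (2 * p)) ℝ, A.IsSymm ∧ B.IsSymm ∧
      HasOrdSpecR A σ ∧ HasOrdSpecR B σ ∧ HasOrdSpecR (A + B) (dupR ν)) :
    (∃ a b : Matrix (Fin p) (Fin p) ℝ, a.IsSymm ∧ b.IsSymm ∧
      HasOrdSpecR a (sminusR σ) ∧ HasOrdSpecR b (splusR σ) ∧ HasOrdSpecR (a + b) ν) := by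
  obtain ⟨A, B, hA, hB, ⟨-, hAc⟩, ⟨-, hBc⟩, ⟨-, hCc⟩⟩ := h
  have m1 : Antitone (sminusR σ) := by
    intro i j hij
    exact hσ (Fin.mk_le_mk.mpr (Nat.mul_le_mul_left 2 hij))
  have m2 : Antitone (splusR σ) := by
    intro i j hij
    exact hσ (Fin.mk_le_mk.mpr (Nat.add_le_add_right (Nat.mul_le_mul_left 2 hij) 1))
  rcases Nat.eq_zero_or_pos p with rfl | hp
  · refine ⟨0, 0, by simp, by simp, ⟨m1, ?_⟩, ⟨m2, ?_⟩, ⟨hν, ?_⟩⟩ <;> simp [Matrix.charpoly]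
  · obtain ⟨OA, hOA, eA⟩ := diag_of_spec A hA σ hAc
    obtain ⟨OB, hOB, eB⟩ := diag_of_spec B hB σ hBc
    obtain ⟨OC, hOC, eC⟩ := diag_of_spec (A + B) (by rw [transpose_add, hA.eq, hB.eq]) (dupR ν) hCc
    obtain ⟨O, hO, hsum⟩ := hard_limit hp σ hσ ν OA OB OC hOA hOB hOC (by rw [← eA, ← eB, ← eC])
    have hsg : sg σ 0 = σ := by funext i; simp [sg]
    rw [Fin.sum_univ_three] at hsum
    have f0 : dd σ ν 0 0 = sminusR σ := by simp only [dd, hsg]; rfl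
    have f1 : dd σ ν 0 1 = splusR σ := by simp only [dd, hsg]; rfl
    have f2 : diagonal (dd σ ν 0 2) = - diagonal ν := by rw [diagonal_neg]; rfl
    rw [f0, f1, f2, Matrix.mul_neg, Matrix.neg_mul, ← sub_eq_add_neg, sub_eq_zero] at hsum
    refine ⟨O 0 * diagonal (sminusR σ) * (O 0)ᵀ, O 1 * diagonal (splusR σ) * (O 1)ᵀ, ?_, ?_, ⟨m1, spec_conj _ (hO 0) _⟩,
      ⟨m2, spec_conj _ (hO 1) _⟩, hν, ?_⟩
    · simp [Matrix.IsSymm, transpose_mul, Matrix.mul_assoc]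
    · simp [Matrix.IsSymm, transpose_mul, Matrix.mul_assoc]
    · rw [hsum]
      exact spec_conj _ (hO 2) _

theorem easy_dir (p : ℕ)
    (σ : Fin (2 * p) → ℝ) (hσ : Antitone σ) (ν : Fin p → ℝ) (hν : Antitone ν)
    (h : ∃ a b : Matrix (Fin p) (Fin p) ℝ, a.IsSymm ∧ b.IsSymm ∧
      HasOrdSpecR a (sminusR σ) ∧ HasOrdSpecR b (splusR σ) ∧ HasOrdSpecR (a + b) ν) :
    (∃ A B : Matrix (Fin (2 * p)) (Fin (2 * p)) ℝ, A.IsSymm ∧ B.IsSymm ∧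
      HasOrdSpecR A σ ∧ HasOrdSpecR B σ ∧ HasOrdSpecR (A + B) (dupR ν)) := by
  obtain ⟨a, b, ha, hb, ⟨-, hac⟩, ⟨-, hbc⟩, ⟨-, hcc⟩⟩ := h
  have hsig : ∏ i, (Polynomial.X - Polynomial.C (σ i)) = (∏ i, (Polynomial.X - Polynomial.C (sminusR σ i)))
      * ∏ i, (Polynomial.X - Polynomial.C (splusR σ i)) := by
    rw [← Equiv.prod_comp (evenOdd p), Fintype.prod_sum_type]
    rfl
  have hnu : ∏ i, (Polynomial.X - Polynomial.C (dupR ν i)) = (∏ i, (Polynomial.X - Polynomial.C (ν i)))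
      * ∏ i, (Polynomial.X - Polynomial.C (ν i)) := by
    rw [← Equiv.prod_comp (evenOdd p), Fintype.prod_sum_type]
    have h1 := evenOdd_dup ν
    congr 1
    · exact Finset.prod_congr rfl fun i _ => by rw [show dupR ν (evenOdd p (Sum.inl i)) = ν i from congrFun h1 (Sum.inl i)]
    · exact Finset.prod_congr rfl fun i _ => by rw [show dupR ν (evenOdd p (Sum.inr i)) = ν i from congrFun h1 (Sum.inr i)]
  refine ⟨reindex (evenOdd p) (evenOdd p) (fromBlocks a 0 0 b), reindex (evenOdd p) (evenOdd p) (fromBlocks b 0 0 a), ?_, ?_,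
    ⟨hσ, ?_⟩, ⟨hσ, ?_⟩, ?_, ?_⟩
  · rw [Matrix.IsSymm, transpose_reindex, fromBlocks_transpose, ha.eq, hb.eq, transpose_zero]
  · rw [Matrix.IsSymm, transpose_reindex, fromBlocks_transpose, ha.eq, hb.eq, transpose_zero]
  · rw [charpoly_reindex, charpoly_fromBlocks_zero₁₂, hac, hbc, hsig]
  · rw [charpoly_reindex, charpoly_fromBlocks_zero₁₂, hac, hbc, hsig, mul_comm]
  · intro i j hij
    exact hν (Fin.mk_le_mk.mpr (Nat.div_le_div_right hij))
  · have : reindex (evenOdd p) (evenOdd p) (fromBlocks a 0 0 b) + reindex (evenOdd p) (evenOdd p) (fromBlocks b 0 0 a)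
        = reindex (evenOdd p) (evenOdd p) (fromBlocks (a + b) 0 0 (a + b)) := by
      have h1 : fromBlocks (a + b) 0 0 (a + b) = fromBlocks a 0 0 b + fromBlocks b 0 0 a := by
        rw [fromBlocks_add, add_comm b a]; simp
      rw [h1]; rfl
    rw [this, charpoly_reindex, charpoly_fromBlocks_zero₁₂, hcc, hnu]

end

/-- For weakly decreasing `σ ∈ ℝ^{2p}` and `ν ∈ ℝ^p`: there exist
real symmetric `2p×2p` matrices `A, B`, each with ordered spectrum `σ`, with `A + B`
of ordered spectrum `ν⁽²⁾`, iff there exist real symmetric `p×p` matrices `a, b`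
with ordered spectra `σ₋, σ₊` and `a + b` of ordered spectrum `ν`. -/
theorem horn_doubled_iff_horn_half (p : ℕ)
    (σ : Fin (2 * p) → ℝ) (hσ : Antitone σ) (ν : Fin p → ℝ) (hν : Antitone ν) :
    (∃ A B : Matrix (Fin (2 * p)) (Fin (2 * p)) ℝ, A.IsSymm ∧ B.IsSymm ∧
      HasOrdSpecR A σ ∧ HasOrdSpecR B σ ∧ HasOrdSpecR (A + B) (dupR ν)) ↔
    (∃ a b : Matrix (Fin p) (Fin p) ℝ, a.IsSymm ∧ b.IsSymm ∧
      HasOrdSpecR a (sminusR σ) ∧ HasOrdSpecR b (splusR σ) ∧ HasOrdSpecR (a + b) ν) := by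
  exact ⟨hard_dir p σ hσ ν hν, easy_dir p σ hσ ν hν⟩
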